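/- arXiv:1905.04244 — 7 statements merged into one kernel-verified Lean document; each statement's English description precedes it below -/
import Mathlib

section
/- Let p be a prime and q a power of p. Then U(n,q)^p = {I} if and only if n ≤ p. Moreover, if n = p+1 or n = p+2, then U(n,q)^p = U_{p−1}(n,q). -/
/-- A matrix is lower unitriangular: all diagonal entries are `1` and all entries
above the diagonal are `0`. -/
def IsUnitriangular {n : ℕ} {F : Type*} [Field F] (A : Matrix (Fin n) (Fin n) F) : Prop :=
  (∀ i, A i i = 1) ∧ ∀ i j : Fin n, i < j → A i j = 0

/-- Membership in `U_l(n,q)`: a lower unitriangular matrix whose first `l`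
subdiagonals are zero, i.e. `A i j = 0` whenever `i > j` and `i - j ≤ l`. -/
def MemUl {n : ℕ} {F : Type*} [Field F] (l : ℕ) (A : Matrix (Fin n) (Fin n) F) : Prop :=
  IsUnitriangular A ∧ ∀ i j : Fin n, j < i → (i : ℕ) ≤ (j : ℕ) + l → A i j = 0

section UnitriangularPowers

variable {n : ℕ} {F : Type*} [Field F]

/-- Powers of a strictly lower triangular matrix vanish on further and further subdiagonals. -/
theorem Matrix.pow_apply_eq_zero_of_strictLower {N : Matrix (Fin n) (Fin n) F}
    (hN : ∀ i j : Fin n, i ≤ j → N i j = 0) (k : ℕ) (i j : Fin n)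
    (h : (i : ℕ) < j + k) : (N ^ k) i j = 0 := by
  induction k generalizing i with
  | zero => exact Matrix.one_apply_ne (by simpa using ne_of_lt (show i < j from h))
  | succ k ih =>
    rw [pow_succ', Matrix.mul_apply]
    refine Finset.sum_eq_zero fun m _ => ?_
    by_cases him : i ≤ m
    · rw [hN i m him, zero_mul]
    · rw [ih m (by have : m < i := not_le.mp him; omega), mul_zero]

theorem IsUnitriangular.sub_one_apply {A : Matrix (Fin n) (Fin n) F} (hA : IsUnitriangular A)
    (i j : Fin n) (h : i ≤ j) : (A - 1) i j = 0 := by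
  rcases h.lt_or_eq with h | rfl
  · simp [hA.2 i j h, Matrix.one_apply_ne h.ne]
  · simp [hA.1 i]

theorem isUnitriangular_one_add {N : Matrix (Fin n) (Fin n) F}
    (hN : ∀ i j : Fin n, i ≤ j → N i j = 0) : IsUnitriangular (1 + N) :=
  ⟨fun i => by simp [hN i i le_rfl],
    fun i j h => by simp [hN i j h.le, Matrix.one_apply_ne h.ne]⟩

theorem Matrix.one_add_pow_char (p : ℕ) [Fact p.Prime] [CharP F p] [NeZero n]
    (N : Matrix (Fin n) (Fin n) F) : (1 + N) ^ p = 1 + N ^ p := by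
  rw [add_pow_char_of_commute _ (Commute.one_left N), one_pow]

/-- The `j`-th standard basis vector of `Fin n → F`, which is zero for `j ≥ n`. -/
def natBasisVec (n : ℕ) (F : Type*) [Field F] (j : ℕ) : Fin n → F :=
  fun i => if (i : ℕ) = j then 1 else 0

theorem natBasisVec_eq_zero {j : ℕ} (h : n ≤ j) : natBasisVec n F j = 0 := by
  ext i
  simp [natBasisVec, (i.2.trans_le h).ne]

theorem natBasisVec_val (j : Fin n) : natBasisVec n F j = Pi.single j 1 := by
  ext i
  simp [natBasisVec, Pi.single_apply, Fin.ext_iff]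

/-- The matrix with prescribed columns. -/
def matrixOfCols (c : ℕ → Fin n → F) : Matrix (Fin n) (Fin n) F :=
  Matrix.of fun i j => c j i

theorem matrixOfCols_mulVec {c : ℕ → Fin n → F} (hc : ∀ j, n ≤ j → c j = 0) (j : ℕ) :
    (matrixOfCols c).mulVec (natBasisVec n F j) = c j := by
  by_cases h : j < n
  · rw [show natBasisVec n F j = Pi.single ⟨j, h⟩ 1 from natBasisVec_val ⟨j, h⟩,
      Matrix.mulVec_single_one]
    rfl
  · rw [natBasisVec_eq_zero (not_lt.mp h), Matrix.mulVec_zero, hc j (not_lt.mp h)]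

theorem Matrix.apply_eq_mulVec_natBasisVec (M : Matrix (Fin n) (Fin n) F) (i j : Fin n) :
    M i j = M.mulVec (natBasisVec n F j) i := by
  rw [natBasisVec_val, Matrix.mulVec_single_one]
  rfl

theorem Matrix.pow_mulVec_of_chain {N : Matrix (Fin n) (Fin n) F} {v : ℕ → Fin n → F} (k : ℕ)
    (h : ∀ j < k, N.mulVec (v j) = v (j + 1)) : (N ^ k).mulVec (v 0) = v k := by
  induction k with
  | zero => simp
  | succ k ih =>
    rw [pow_succ', ← Matrix.mulVec_mulVec, ih fun j hj => h j (hj.trans k.lt_succ_self),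
      h k k.lt_succ_self]

/-- The shift matrix has nonzero `p`-th power in dimension greater than `p`. -/
theorem exists_strictLower_pow_ne_zero {p : ℕ} (h : p < n) :
    ∃ N : Matrix (Fin n) (Fin n) F, (∀ i j : Fin n, i ≤ j → N i j = 0) ∧ N ^ p ≠ 0 := by
  have hc (j : ℕ) (hj : n ≤ j) : natBasisVec n F (j + 1) = 0 := natBasisVec_eq_zero (by omega)
  refine ⟨matrixOfCols fun j => natBasisVec n F (j + 1), fun i j hij => ?_, fun h0 => ?_⟩
  · have : (i : ℕ) ≠ j + 1 := by have : (i : ℕ) ≤ j := hij; omega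
    simp [matrixOfCols, natBasisVec, this]
  · have := congrFun (Matrix.pow_mulVec_of_chain p
      fun j _ => matrixOfCols_mulVec (F := F) hc j) ⟨p, h⟩
    simp [h0, natBasisVec] at this

/-- Strictly lower triangular matrices realising prescribed first two columns of `N ^ p`, when the
`(p + 1, 1)` entry is nonzero or the `(p, 0)` entry is zero. -/
theorem exists_strictLower_pow_of_imp {p : ℕ} (hp : 2 ≤ p) (x y z : F) (hxy : y = 0 → x = 0)
    (hn : 2 < n) :
    ∃ N : Matrix (Fin n) (Fin n) F, (∀ i j : Fin n, i ≤ j → N i j = 0) ∧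
      (N ^ p).mulVec (natBasisVec n F 0) =
        x • natBasisVec n F p + z • natBasisVec n F (p + 1) ∧
      (N ^ p).mulVec (natBasisVec n F 1) = y • natBasisVec n F (p + 1) := by
  obtain ⟨q, rfl⟩ : ∃ q, p = q + 2 := ⟨p - 2, by omega⟩
  let e := natBasisVec n F
  let c : ℕ → Fin n → F := fun j =>
    if j = 0 then (x / y) • e 1 + z • e 2 else if j = 1 then y • e 2 else e (j + 1)
  have hc (j : ℕ) (hj : n ≤ j) : c j = 0 := by
    simp only [c]
    rw [if_neg (by omega), if_neg (by omega)]
    exact natBasisVec_eq_zero (by omega)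
  have hmul := matrixOfCols_mulVec hc
  set N := matrixOfCols c with hN
  have h0 : N.mulVec (e 0) = (x / y) • e 1 + z • e 2 := (hmul 0).trans (by simp [c])
  have h1 : N.mulVec (e 1) = y • e 2 := (hmul 1).trans (by simp [c])
  have h2 (k : ℕ) : (N ^ k).mulVec (e 2) = e (k + 2) :=
    Matrix.pow_mulVec_of_chain (v := fun k => e (k + 2)) k
      fun j _ => (hmul (j + 2)).trans (by simp [c, add_right_comm])
  have h1' (k : ℕ) : (N ^ (k + 1)).mulVec (e 1) = y • e (k + 2) := by
    rw [pow_succ, ← Matrix.mulVec_mulVec, h1, Matrix.mulVec_smul, h2]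
  refine ⟨N, fun i j hij => ?_, ?_, h1' _⟩
  · have hij' : (i : ℕ) ≤ j := hij
    have a1 : (i : ℕ) ≠ j + 1 := by omega
    simp only [hN, matrixOfCols, c, Matrix.of_apply]
    split_ifs with hj hj'
    · simp [e, natBasisVec, show (i : ℕ) = 0 by omega]
    · simp [e, natBasisVec, show (i : ℕ) ≠ 2 by omega]
    · simp [e, natBasisVec, a1]
  · change (N ^ (q + 2)).mulVec (e 0) = _
    rw [pow_succ, ← Matrix.mulVec_mulVec, h0, Matrix.mulVec_add, Matrix.mulVec_smul,
      Matrix.mulVec_smul, h2, h1', smul_smul, div_mul_cancel_of_imp hxy]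

/-- Strictly lower triangular matrices realising prescribed first two columns of `N ^ p`, when the
second one is zero. -/
theorem exists_strictLower_pow_of_second_eq_zero {p : ℕ} (hp : 2 ≤ p) (x z : F) :
    ∃ N : Matrix (Fin n) (Fin n) F, (∀ i j : Fin n, i ≤ j → N i j = 0) ∧
      (N ^ p).mulVec (natBasisVec n F 0) =
        x • natBasisVec n F p + z • natBasisVec n F (p + 1) ∧
      (N ^ p).mulVec (natBasisVec n F 1) = 0 := by
  obtain ⟨q, rfl⟩ : ∃ q, p = q + 2 := ⟨p - 2, by omega⟩
  let e := natBasisVec n F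
  let c : ℕ → Fin n → F := fun j =>
    if n ≤ j then 0 else
    if j < q + 1 then e (j + 1) else if j = q + 1 then x • e (q + 2) + z • e (q + 3) else 0
  have hmul := matrixOfCols_mulVec (c := c) fun j hj => if_pos hj
  set N := matrixOfCols c with hN
  have hlt (j : ℕ) (hj : j < q + 1) : N.mulVec (e j) = e (j + 1) := by
    refine (hmul j).trans ?_
    simp only [c, if_pos hj]
    split_ifs with h
    · exact (natBasisVec_eq_zero (by omega)).symm
    · rfl
  have heq : N.mulVec (e (q + 1)) = x • e (q + 2) + z • e (q + 3) := by
    refine (hmul (q + 1)).trans ?_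
    simp only [c, lt_irrefl, if_false, if_true]
    split_ifs with h
    · simp [e, natBasisVec_eq_zero (F := F) (show n ≤ q + 2 by omega),
        natBasisVec_eq_zero (F := F) (show n ≤ q + 3 by omega)]
    · rfl
  have hgt (j : ℕ) (hj : q + 1 < j) : N.mulVec (e j) = 0 :=
    (hmul j).trans (by simp [c, hj.ne', show ¬ j ≤ q by omega])
  have h0 : (N ^ (q + 2)).mulVec (e 0) = x • e (q + 2) + z • e (q + 3) := by
    rw [pow_succ', ← Matrix.mulVec_mulVec, Matrix.pow_mulVec_of_chain (q + 1) hlt, heq]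
  refine ⟨N, fun i j hij => ?_, h0, ?_⟩
  · have hij' : (i : ℕ) ≤ j := hij
    simp only [hN, matrixOfCols, c, Matrix.of_apply]
    split_ifs with hj hj' hj''
    · rfl
    · simp [e, natBasisVec, show (i : ℕ) ≠ j + 1 by omega]
    · simp [e, natBasisVec, show (i : ℕ) ≠ q + 2 by omega, show (i : ℕ) ≠ q + 3 by omega]
    · rfl
  · change (N ^ (q + 2)).mulVec (e 1) = 0
    rw [← hlt 0 (by omega), Matrix.mulVec_mulVec, ← pow_succ, pow_succ', ← Matrix.mulVec_mulVec,
      h0, Matrix.mulVec_add, Matrix.mulVec_smul, Matrix.mulVec_smul, hgt _ (by omega),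
      hgt _ (by omega), smul_zero, smul_zero, add_zero]

theorem exists_strictLower_pow {p : ℕ} (hp : 2 ≤ p) (hn : 2 < n) (x y z : F) :
    ∃ N : Matrix (Fin n) (Fin n) F, (∀ i j : Fin n, i ≤ j → N i j = 0) ∧
      (N ^ p).mulVec (natBasisVec n F 0) =
        x • natBasisVec n F p + z • natBasisVec n F (p + 1) ∧
      (N ^ p).mulVec (natBasisVec n F 1) = y • natBasisVec n F (p + 1) := by
  by_cases hy : y = 0
  · simpa [hy] using exists_strictLower_pow_of_second_eq_zero hp x z
  · exact exists_strictLower_pow_of_imp hp x y z (fun h => absurd h hy) hn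

/-- In dimension at most `p + 2`, every matrix supported on subdiagonals `p` and beyond is the
`p`-th power of a strictly lower triangular matrix. -/
theorem exists_strictLower_pow_eq {p : ℕ} (hp : 2 ≤ p) (hpn : p < n) (hn : n ≤ p + 2)
    (M : Matrix (Fin n) (Fin n) F) (hM : ∀ i j : Fin n, (i : ℕ) < j + p → M i j = 0) :
    ∃ N : Matrix (Fin n) (Fin n) F, (∀ i j : Fin n, i ≤ j → N i j = 0) ∧ N ^ p = M := by
  obtain ⟨N, hN, h0, h1⟩ := exists_strictLower_pow (n := n) hp (by omega)
    (M ⟨p, hpn⟩ ⟨0, by omega⟩)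
    (if h : p + 1 < n then M ⟨p + 1, h⟩ ⟨1, by omega⟩ else 0)
    (if h : p + 1 < n then M ⟨p + 1, h⟩ ⟨0, by omega⟩ else 0)
  refine ⟨N, hN, ?_⟩
  ext i j
  by_cases hij : (i : ℕ) < j + p
  · rw [hM i j hij, Matrix.pow_apply_eq_zero_of_strictLower hN p i j hij]
  rw [Matrix.apply_eq_mulVec_natBasisVec (N ^ p) i j]
  obtain ⟨i, hi⟩ := i
  obtain ⟨j, hj⟩ := j
  simp only at hij ⊢
  obtain ⟨rfl, rfl⟩ | ⟨rfl, rfl⟩ | ⟨rfl, rfl⟩ :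
      (i = p ∧ j = 0) ∨ (i = p + 1 ∧ j = 0) ∨ (i = p + 1 ∧ j = 1) := by omega
  · rw [h0, Pi.add_apply, Pi.smul_apply, Pi.smul_apply]
    simp [natBasisVec]
  · simp [h0, natBasisVec, hi]
  · simp [h1, natBasisVec, hi]

end UnitriangularPowers

theorem pPowerPaper.stmt2 (p e : ℕ) (hp : p.Prime) (he : 0 < e)
    (F : Type*) [Field F] [Fintype F] (hF : Fintype.card F = p ^ e)
    (n : ℕ) (hn : 0 < n) :
    ({B : Matrix (Fin n) (Fin n) F | ∃ A, IsUnitriangular A ∧ A ^ p = B} = {1} ↔ n ≤ p) ∧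
    ((n = p + 1 ∨ n = p + 2) →
      {B : Matrix (Fin n) (Fin n) F | ∃ A, IsUnitriangular A ∧ A ^ p = B}
        = {B | MemUl (p - 1) B}) := by
  have : Fact p.Prime := ⟨hp⟩
  have : NeZero n := ⟨hn.ne'⟩
  have : CharP F p := charP_of_card_eq_prime_pow hF
  have hpow (A : Matrix (Fin n) (Fin n) F) : A ^ p = 1 + (A - 1) ^ p := by
    rw [← Matrix.one_add_pow_char, add_sub_cancel]
  have hvanish {A : Matrix (Fin n) (Fin n) F} (hA : IsUnitriangular A) (i j : Fin n)
      (h : (i : ℕ) < j + p) : ((A - 1) ^ p) i j = 0 :=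
    Matrix.pow_apply_eq_zero_of_strictLower hA.sub_one_apply p i j h
  refine ⟨⟨fun h => ?_, fun h => ?_⟩, fun h => ?_⟩
  · by_contra! hlt
    obtain ⟨N, hN, hNp⟩ := exists_strictLower_pow_ne_zero (F := F) hlt
    have : (1 + N) ^ p = 1 := by
      rw [← Set.mem_singleton_iff, ← h]
      exact ⟨_, isUnitriangular_one_add hN, rfl⟩
    rw [Matrix.one_add_pow_char, add_eq_left] at this
    exact hNp this
  · rw [Set.eq_singleton_iff_unique_mem]
    refine ⟨⟨1, ⟨fun i => by simp, fun i j hij => Matrix.one_apply_ne hij.ne⟩, one_pow p⟩, ?_⟩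
    rintro _ ⟨A, hA, rfl⟩
    rw [hpow, add_eq_left]
    ext i j
    exact hvanish hA i j (by omega)
  · ext B
    constructor
    · rintro ⟨A, hA, rfl⟩
      have hp0 := hp.pos
      rw [Set.mem_ofPred_eq, hpow]
      refine ⟨isUnitriangular_one_add fun i j hij => hvanish hA i j ?_, fun i j hji hij => ?_⟩
      · have : (i : ℕ) ≤ j := hij
        omega
      · rw [Matrix.add_apply, Matrix.one_apply_ne hji.ne', hvanish hA i j (by omega), add_zero]
    · rintro ⟨hB, hBl⟩
      obtain ⟨N, hN, hNp⟩ := exists_strictLower_pow_eq hp.two_le (by omega) (by omega) (B - 1)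
        fun i j hij => by
          rcases le_or_gt i j with h | h
          · exact hB.sub_one_apply i j h
          · rw [Matrix.sub_apply, hBl i j h (by omega), Matrix.one_apply_ne h.ne', sub_zero]
      exact ⟨1 + N, isUnitriangular_one_add hN, by
        rw [Matrix.one_add_pow_char, hNp, add_sub_cancel]⟩
end

section
/- Let p be a prime and q a power of p, and let n ≥ p+3 be an integer. Then U(n,q)^p is a proper subset of U_{p−1}(n,q), and the subgroup of U(n,q) generated by the set U(n,q)^p equals U_{p−1}(n,q). -/
/-- All entries of `A` strictly above the `k`-th subdiagonal vanish. -/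
def Matrix.IsBelowSubdiagonal {n : ℕ} {R : Type*} [Zero R] (k : ℕ)
    (A : Matrix (Fin n) (Fin n) R) : Prop :=
  ∀ i j : Fin n, (i : ℕ) < (j : ℕ) + k → A i j = 0

namespace Matrix.IsBelowSubdiagonal

variable {n : ℕ} {R : Type*} [Ring R] {a b : ℕ} {A B : Matrix (Fin n) (Fin n) R}

lemma add (hA : A.IsBelowSubdiagonal a) (hB : B.IsBelowSubdiagonal a) :
    (A + B).IsBelowSubdiagonal a := fun i j h => by
  simp [hA i j h, hB i j h]

lemma mono (hA : A.IsBelowSubdiagonal a) (hab : b ≤ a) : A.IsBelowSubdiagonal b :=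
  fun i j h => hA i j (by omega)

lemma mul (hA : A.IsBelowSubdiagonal a) (hB : B.IsBelowSubdiagonal b) :
    (A * B).IsBelowSubdiagonal (a + b) := fun i j h => by
  rw [Matrix.mul_apply]
  refine Finset.sum_eq_zero fun m _ => ?_
  by_cases hm : (m : ℕ) < (j : ℕ) + b
  · rw [hB m j hm, mul_zero]
  · rw [hA i m (by omega), zero_mul]

/-- Entries on the lowest possibly nonzero subdiagonal of a product are single products. -/
lemma mul_apply_of_eq (hA : A.IsBelowSubdiagonal a) (hB : B.IsBelowSubdiagonal b)
    {i m j : Fin n} (him : (i : ℕ) = (m : ℕ) + a) (hmj : (m : ℕ) = (j : ℕ) + b) :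
    (A * B) i j = A i m * B m j := by
  rw [Matrix.mul_apply]
  refine Finset.sum_eq_single m (fun x _ hx => ?_) (by simp)
  have hx' : (x : ℕ) ≠ (m : ℕ) := fun h => hx (Fin.ext h)
  by_cases hxj : (x : ℕ) < (j : ℕ) + b
  · rw [hB x j hxj, mul_zero]
  · rw [hA i x (by omega), zero_mul]

lemma one : (1 : Matrix (Fin n) (Fin n) R).IsBelowSubdiagonal 0 := fun i j h => by
  rw [Matrix.one_apply_ne]
  rintro rfl
  omega

lemma pow (hA : A.IsBelowSubdiagonal a) (k : ℕ) : (A ^ k).IsBelowSubdiagonal (k * a) := by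
  induction k with
  | zero => simpa using one
  | succ k ih =>
    rw [pow_succ, Nat.succ_mul]
    exact ih.mul hA

lemma pow_of_one (hA : A.IsBelowSubdiagonal 1) (k : ℕ) : (A ^ k).IsBelowSubdiagonal k := by
  simpa using hA.pow k

lemma isNilpotent (hA : A.IsBelowSubdiagonal 1) : IsNilpotent A :=
  ⟨n, by
    ext i j
    exact hA.pow_of_one n i j (by omega)⟩

lemma single {i j : Fin n} (h : (j : ℕ) + a ≤ (i : ℕ)) (c : R) :
    (Matrix.single i j c).IsBelowSubdiagonal a := fun x y hxy => by
  rw [Matrix.single_apply, if_neg]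
  rintro ⟨rfl, rfl⟩
  omega

/-- If the first and third entries on the `p`-th subdiagonal of the `p`-th power of a strictly
lower triangular matrix are nonzero, then so is the second one. -/
lemma pow_apply_ne_zero [NoZeroDivisors R] (hA : A.IsBelowSubdiagonal 1) {p : ℕ} (hp : 2 ≤ p)
    (hn : p + 3 ≤ n) (h₀ : (A ^ p) ⟨p, by omega⟩ ⟨0, by omega⟩ ≠ 0)
    (h₂ : (A ^ p) ⟨p + 2, by omega⟩ ⟨2, by omega⟩ ≠ 0) :
    (A ^ p) ⟨p + 1, by omega⟩ ⟨1, by omega⟩ ≠ 0 := by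
  obtain ⟨k, rfl⟩ : ∃ k, p = k + 2 := ⟨p - 2, by omega⟩
  have hk := hA.pow_of_one k
  have hk' : (A * A ^ k).IsBelowSubdiagonal (1 + k) := hA.mul hk
  have hk₁ := hA.pow_of_one (k + 1)
  rw [pow_succ, mul_apply_of_eq hk₁ hA (m := ⟨1, by omega⟩) (by simp; omega) rfl] at h₀
  rw [pow_succ', pow_succ', mul_apply_of_eq hA hk' (m := ⟨k + 3, by omega⟩) rfl (by simp; omega),
    mul_apply_of_eq hA hk (m := ⟨k + 2, by omega⟩) rfl (by simp; omega)] at h₂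
  rw [pow_succ', mul_apply_of_eq hA hk₁ (m := ⟨k + 2, by omega⟩) rfl (by simp; omega)]
  exact mul_ne_zero (left_ne_zero_of_mul (right_ne_zero_of_mul h₂)) (left_ne_zero_of_mul h₀)

end Matrix.IsBelowSubdiagonal

lemma add_pow_succ_of_mul_eq_zero {R : Type*} [Ring R] {x y : R} (hyx : y * x = 0)
    (hyy : y * y = 0) (m : ℕ) : (x + y) ^ (m + 1) = x ^ (m + 1) + x ^ m * y := by
  induction m with
  | zero => simp
  | succ m ih =>
    rw [pow_succ, ih, add_mul, mul_add, mul_add, mul_assoc _ y x, mul_assoc _ y y, hyx, hyy]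
    simp [pow_succ]

/-- A scalar multiple of a matrix unit on or below the `(k + 1)`-st subdiagonal is a `(k + 1)`-st
power of a strictly lower triangular matrix. -/
lemma Matrix.exists_pow_succ_eq_single {n : ℕ} {R : Type*} [Ring R] (c : R) (k : ℕ)
    (i j : Fin n) (h : (j : ℕ) + (k + 1) ≤ (i : ℕ)) :
    ∃ N : Matrix (Fin n) (Fin n) R, N.IsBelowSubdiagonal 1 ∧ (∀ x y : Fin n, y < j → N x y = 0) ∧
      (∀ x, N x i = 0) ∧ N ^ (k + 1) = Matrix.single i j c := by
  induction k generalizing j with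
  | zero =>
    refine ⟨Matrix.single i j c, .single h c, fun x y hy => ?_, fun x => ?_, by simp⟩
    · rw [Matrix.single_apply, if_neg]
      rintro ⟨-, rfl⟩
      exact lt_irrefl _ hy
    · rw [Matrix.single_apply, if_neg]
      rintro ⟨-, rfl⟩
      omega
  | succ k ih =>
    have hi := i.isLt
    set j' : Fin n := ⟨j + 1, by omega⟩ with hj'
    have hj'v : (j' : ℕ) = j + 1 := rfl
    obtain ⟨N, hN, hcol, hNi, hpow⟩ := ih j' (by omega)
    have hEN : Matrix.single j' j (1 : R) * N = 0 := by
      ext x y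
      by_cases hx : x = j'
      · subst hx
        simp only [Matrix.single_mul_apply_same, one_mul, Matrix.zero_apply]
        by_cases hy : y < j'
        · exact hcol _ _ hy
        · exact hN _ _ (by rw [Fin.lt_def] at hy; omega)
      · exact Matrix.single_mul_apply_of_ne _ _ _ _ _ hx _
    have hne : j ≠ j' := fun e => by
      have := congrArg Fin.val e
      omega
    have hEE : Matrix.single j' j (1 : R) * Matrix.single j' j (1 : R) = 0 :=
      Matrix.single_mul_single_of_ne _ _ _ _ hne _
    have hNE : N * Matrix.single i j' c = 0 := by
      ext x y
      by_cases hy : y = j'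
      · subst hy
        simp [hNi]
      · exact Matrix.mul_single_apply_of_ne _ _ _ _ _ hy _
    refine ⟨N + Matrix.single j' j 1, hN.add (.single le_rfl 1), fun x y hy => ?_, fun x => ?_, ?_⟩
    · rw [Matrix.add_apply, hcol x y (by rw [Fin.lt_def] at *; omega), Matrix.single_apply, if_neg,
        add_zero]
      rintro ⟨-, rfl⟩
      exact lt_irrefl _ hy
    · rw [Matrix.add_apply, hNi, Matrix.single_apply, if_neg, add_zero]
      rintro ⟨-, rfl⟩
      omega
    · rw [add_pow_succ_of_mul_eq_zero hEN hEE, pow_succ' N, hpow, hNE,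
        Matrix.single_mul_single_same, zero_add, mul_one]

/-- A property of matrices that is multiplicative and holds for the identity and for the
transvections on or below the `k`-th subdiagonal, `0 < k`, holds for every unitriangular matrix
whose first `k - 1` subdiagonals vanish. -/
lemma Matrix.one_add_induction_single {n : ℕ} {R : Type*} [Ring R] {k : ℕ} (hk : 0 < k)
    (P : Matrix (Fin n) (Fin n) R → Prop) (h_one : P 1) (h_mul : ∀ A B, P A → P B → P (A * B))
    (h_single : ∀ (i j : Fin n) (c : R), (j : ℕ) + k ≤ (i : ℕ) → P (1 + Matrix.single i j c))
    (M : Matrix (Fin n) (Fin n) R) (hM : M.IsBelowSubdiagonal k) : P (1 + M) := by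
  suffices H : ∀ s : Finset (Fin n ×ₗ Fin n), ∀ M : Matrix (Fin n) (Fin n) R,
      M.IsBelowSubdiagonal k → (∀ i j, M i j ≠ 0 → toLex (j, i) ∈ s) → P (1 + M) from
    H Finset.univ M hM fun _ _ _ => Finset.mem_univ _
  intro s
  induction s using Finset.induction_on_max with
  | empty =>
    intro M _ hs
    have : M = 0 := by
      ext i j
      by_contra h
      simpa using hs i j h
    rwa [this, add_zero]
  | insert t s ht ih =>
    intro M hM hs
    obtain ⟨⟨b, a⟩, rfl⟩ := toLex.surjective t
    set c := M a b with hc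
    have hM'ab : (M - Matrix.single a b c) a b = 0 := by simp [hc]
    have hM'ne : ∀ i j, ¬ (a = i ∧ b = j) → (M - Matrix.single a b c) i j = M i j := by
      intro i j h
      rw [Matrix.sub_apply, Matrix.single_apply, if_neg h, sub_zero]
    have hM' : (M - Matrix.single a b c).IsBelowSubdiagonal k := by
      intro i j hij
      by_cases h : a = i ∧ b = j
      · obtain ⟨rfl, rfl⟩ := h
        exact hM'ab
      · rw [hM'ne i j h, hM i j hij]
    have hs' : ∀ i j, (M - Matrix.single a b c) i j ≠ 0 → toLex (j, i) ∈ s := by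
      intro i j hij
      by_cases h : a = i ∧ b = j
      · obtain ⟨rfl, rfl⟩ := h
        exact absurd hM'ab hij
      · rw [hM'ne i j h] at hij
        refine (Finset.mem_insert.1 (hs i j hij)).resolve_left fun e => h ?_
        have := toLex.injective e
        rw [Prod.mk.injEq] at this
        exact ⟨this.2.symm, this.1.symm⟩
    by_cases hab : (b : ℕ) + k ≤ (a : ℕ)
    · have hzero : (M - Matrix.single a b c) * Matrix.single a b c = 0 := by
        ext x y
        by_cases hy : y = b
        · subst hy
          rw [Matrix.mul_single_apply_same, Matrix.zero_apply]
          suffices (M - Matrix.single a y c) x a = 0 by rw [this, zero_mul]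
          by_contra hne
          have hlt := ht _ (hs' x a hne)
          rw [Prod.Lex.toLex_lt_toLex, Fin.lt_def, Fin.ext_iff] at hlt
          simp only at hlt
          omega
        · exact Matrix.mul_single_apply_of_ne _ _ _ _ _ hy _
      have hfac : 1 + M = (1 + (M - Matrix.single a b c)) * (1 + Matrix.single a b c) := by
        rw [add_mul, mul_add, mul_add, hzero]
        simp
      rw [hfac]
      exact h_mul _ _ (ih _ hM' hs') (h_single _ _ _ hab)
    · have hc0 : c = 0 := hM a b (by omega)
      rw [hc0, Matrix.single_zero, sub_zero] at hs'
      exact ih M hM hs'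

lemma memUl_iff {n : ℕ} {F : Type*} [Field F] {l : ℕ} {A : Matrix (Fin n) (Fin n) F} :
    MemUl l A ↔ (A - 1).IsBelowSubdiagonal (l + 1) := by
  constructor
  · rintro ⟨⟨hd, hu⟩, hl⟩ i j hij
    rcases lt_trichotomy i j with h | rfl | h
    · rw [Matrix.sub_apply, hu i j h, Matrix.one_apply_ne h.ne, sub_zero]
    · rw [Matrix.sub_apply, hd, Matrix.one_apply_eq, sub_self]
    · rw [Matrix.sub_apply, hl i j h (by omega), Matrix.one_apply_ne h.ne', sub_zero]
  · intro h
    refine ⟨⟨fun i => ?_, fun i j hij => ?_⟩, fun i j hij hl => ?_⟩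
    · simpa [sub_eq_zero] using h i i (by omega)
    · simpa [Matrix.one_apply_ne hij.ne] using h i j (by rw [Fin.lt_def] at hij; omega)
    · simpa [Matrix.one_apply_ne hij.ne'] using h i j (by omega)

lemma isUnitriangular_iff {n : ℕ} {F : Type*} [Field F] {A : Matrix (Fin n) (Fin n) F} :
    IsUnitriangular A ↔ (A - 1).IsBelowSubdiagonal 1 := by
  rw [← zero_add 1, ← memUl_iff]
  refine ⟨fun h => ⟨h, fun i j hij hl => ?_⟩, fun h => h.1⟩
  rw [Fin.lt_def] at hij
  omega

lemma MemUl.mul {n : ℕ} {F : Type*} [Field F] {l : ℕ} {A B : Matrix (Fin n) (Fin n) F}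
    (hA : MemUl l A) (hB : MemUl l B) : MemUl l (A * B) := by
  rw [memUl_iff] at *
  have : A * B - 1 = (A - 1) * (B - 1) + ((A - 1) + (B - 1)) := by noncomm_ring
  rw [this]
  exact ((hA.mul hB).mono (by omega)).add (hA.add hB)

lemma MemUl.one {n : ℕ} {F : Type*} [Field F] {l : ℕ} :
    MemUl l (1 : Matrix (Fin n) (Fin n) F) := by
  rw [memUl_iff, sub_self]
  exact fun _ _ _ => rfl

/-- The subgroup of matrices in `U_l(n, q)`. -/
def unitriangularSubgroup (n : ℕ) (F : Type*) [Field F] [Finite F] (l : ℕ) :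
    Subgroup (Matrix (Fin n) (Fin n) F)ˣ where
  carrier := {g | MemUl l (g : Matrix (Fin n) (Fin n) F)}
  one_mem' := MemUl.one
  mul_mem' ha hb := MemUl.mul ha hb
  inv_mem' {x} hx := by
    have hpow : ∀ m : ℕ, MemUl l ((x ^ m : (Matrix (Fin n) (Fin n) F)ˣ) :
        Matrix (Fin n) (Fin n) F) := by
      intro m
      induction m with
      | zero => simpa using MemUl.one
      | succ m ih =>
        rw [pow_succ, Units.val_mul]
        exact ih.mul hx
    have hinv : x⁻¹ = x ^ (orderOf x - 1) := by
      rw [inv_eq_iff_mul_eq_one, ← pow_succ', Nat.sub_add_cancel (orderOf_pos x), pow_orderOf_eq_one]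
    rw [hinv]
    exact hpow _

/-- The set `U(n,q)^p` of `p`-th powers of lower unitriangular matrices, viewed inside
the group of units of the matrix ring. -/
theorem pPowerPaper.stmt3 (p e : ℕ) (hp : p.Prime) (he : 0 < e)
    (F : Type*) [Field F] [Fintype F] (hF : Fintype.card F = p ^ e)
    (n : ℕ) (hn : p + 3 ≤ n) :
    ({g : (Matrix (Fin n) (Fin n) F)ˣ |
        ∃ h : (Matrix (Fin n) (Fin n) F)ˣ, IsUnitriangular (h : Matrix (Fin n) (Fin n) F)
          ∧ g = h ^ p}
      ⊂ {g : (Matrix (Fin n) (Fin n) F)ˣ | MemUl (p - 1) (g : Matrix (Fin n) (Fin n) F)}) ∧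
    ((Subgroup.closure {g : (Matrix (Fin n) (Fin n) F)ˣ |
        ∃ h : (Matrix (Fin n) (Fin n) F)ˣ, IsUnitriangular (h : Matrix (Fin n) (Fin n) F)
          ∧ g = h ^ p} : Set (Matrix (Fin n) (Fin n) F)ˣ)
      = {g : (Matrix (Fin n) (Fin n) F)ˣ | MemUl (p - 1) (g : Matrix (Fin n) (Fin n) F)}) := by
  have : Fact p.Prime := ⟨hp⟩
  have : CharP F p := charP_of_card_eq_prime_pow hF
  have : NeZero n := ⟨by omega⟩
  have hp2 := hp.two_le
  have hp1 : p - 1 + 1 = p := by omega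
  have hpow : ∀ A : Matrix (Fin n) (Fin n) F, A ^ p - 1 = (A - 1) ^ p := fun A => by
    rw [sub_pow_char_of_commute p (Commute.one_right A), one_pow]
  have hsub : ∀ g : (Matrix (Fin n) (Fin n) F)ˣ,
      (∃ h : (Matrix (Fin n) (Fin n) F)ˣ, IsUnitriangular (h : Matrix (Fin n) (Fin n) F) ∧
        g = h ^ p) → MemUl (p - 1) (g : Matrix (Fin n) (Fin n) F) := by
    rintro _ ⟨h, hh, rfl⟩
    rw [isUnitriangular_iff] at hh
    rw [memUl_iff, Units.val_pow_eq_pow_val, hpow, hp1]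
    exact hh.pow_of_one p
  refine ⟨⟨hsub, fun hall => ?_⟩, Set.Subset.antisymm ?_ fun g hg => ?_⟩
  · set M : Matrix (Fin n) (Fin n) F :=
      Matrix.single ⟨p, by omega⟩ ⟨0, by omega⟩ 1 + Matrix.single ⟨p + 2, by omega⟩ ⟨2, by omega⟩ 1
      with hMdef
    have hM : M.IsBelowSubdiagonal p := .add (.single (by simp) 1) (.single (by simp; omega) 1)
    obtain ⟨u, hu⟩ := (hM.mono (show 1 ≤ p by omega)).isNilpotent.isUnit_one_add
    have hmem : MemUl (p - 1) (u : Matrix (Fin n) (Fin n) F) := by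
      rwa [memUl_iff, hu, hp1, add_sub_cancel_left]
    obtain ⟨h, hh, rfl⟩ := hall hmem
    rw [isUnitriangular_iff] at hh
    have hMN : ((h : Matrix (Fin n) (Fin n) F) - 1) ^ p = M := by
      rw [← hpow, ← Units.val_pow_eq_pow_val, hu, add_sub_cancel_left]
    refine hh.pow_apply_ne_zero hp2 hn ?_ ?_ ?_ <;> rw [hMN] <;>
      simp [hMdef]
  · exact (Subgroup.closure_le (unitriangularSubgroup n F (p - 1))).2 hsub
  · rw [Set.mem_ofPred_eq, memUl_iff, hp1] at hg
    have key := Matrix.one_add_induction_single hp.pos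
      (fun A => ∃ u ∈ Subgroup.closure {g : (Matrix (Fin n) (Fin n) F)ˣ |
        ∃ h : (Matrix (Fin n) (Fin n) F)ˣ, IsUnitriangular (h : Matrix (Fin n) (Fin n) F)
          ∧ g = h ^ p}, (u : Matrix (Fin n) (Fin n) F) = A)
      ⟨1, one_mem _, rfl⟩
      (by
        rintro _ _ ⟨u, hu, rfl⟩ ⟨v, hv, rfl⟩
        exact ⟨u * v, mul_mem hu hv, rfl⟩)
      (by
        intro i j c hij
        obtain ⟨N, hN, -, -, hNp⟩ :=
          Matrix.exists_pow_succ_eq_single c (p - 1) i j (by omega)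
        obtain ⟨u, hu⟩ := hN.isNilpotent.isUnit_one_add
        refine ⟨u ^ p, Subgroup.subset_closure ⟨u, ?_, rfl⟩, ?_⟩
        · rwa [isUnitriangular_iff, hu, add_sub_cancel_left]
        · rw [← sub_eq_iff_eq_add', Units.val_pow_eq_pow_val, hpow, hu, add_sub_cancel_left,
            ← hNp, hp1])
      _ hg
    obtain ⟨u, hu, hug⟩ := key
    rw [add_sub_cancel] at hug
    rw [← Units.ext hug]
    exact hu
end

section
/- Let p be a prime and q a power of p, and let n ≥ p+3 be an integer with q ≥ n−p−1. Then |U(n,q)^p| > (1/3)|U_{p−1}(n,q)|. -/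
namespace pPowerPaper

open Matrix

variable {F : Type*} [Field F] {n : ℕ}

/-- The orbit of the first `p` standard basis vectors under `M`: `powerOrbit M p i` is the `i`-th
basis vector for `i < p`, and `M` applied to `powerOrbit M p (i - p)` otherwise. -/
def powerOrbit (M : Matrix (Fin n) (Fin n) F) (p : ℕ) (i : ℕ) : Fin n → F :=
  if _h : i < p ∨ p = 0 then fun k => if (k : ℕ) = i then 1 else 0
  else M *ᵥ powerOrbit M p (i - p)
termination_by i
decreasing_by omega

lemma powerOrbit_of_lt (M : Matrix (Fin n) (Fin n) F) {p i : ℕ} (h : i < p) :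
    powerOrbit M p i = fun k : Fin n => if (k : ℕ) = i then 1 else 0 := by
  rw [powerOrbit, dif_pos (Or.inl h)]

lemma powerOrbit_add (M : Matrix (Fin n) (Fin n) F) {p : ℕ} (hp : 0 < p) (i : ℕ) :
    powerOrbit M p (i + p) = M *ᵥ powerOrbit M p i := by
  rw [powerOrbit, dif_neg (by omega), Nat.add_sub_cancel]

lemma powerOrbit_apply_eq_zero {M : Matrix (Fin n) (Fin n) F} {p : ℕ} (hp : 0 < p)
    (hM : ∀ i j : Fin n, (i : ℕ) < j + p → M i j = 0) (i : ℕ) :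
    ∀ k : Fin n, (k : ℕ) < i → powerOrbit M p i k = 0 := by
  induction i using Nat.strong_induction_on with
  | _ i ih =>
    intro k hk
    by_cases hi : i < p
    · simp [powerOrbit_of_lt M hi, hk.ne]
    · obtain ⟨j, rfl⟩ := Nat.exists_eq_add_of_le' (not_lt.mp hi)
      rw [powerOrbit_add M hp, mulVec, dotProduct]
      refine Finset.sum_eq_zero fun l _ => ?_
      by_cases hl : (l : ℕ) < j
      · rw [ih j (by omega) l hl, mul_zero]
      · rw [hM k l (by omega), zero_mul]

lemma powerOrbit_apply_self_ne_zero {M : Matrix (Fin n) (Fin n) F} {p : ℕ} (hp : 0 < p)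
    (hM : ∀ i j : Fin n, (i : ℕ) < j + p → M i j = 0)
    (hM' : ∀ i j : Fin n, (i : ℕ) = j + p → (i : ℕ) + 1 < n → M i j ≠ 0) (i : ℕ) :
    ∀ k : Fin n, (k : ℕ) = i → i + 1 < n → powerOrbit M p i k ≠ 0 := by
  induction i using Nat.strong_induction_on with
  | _ i ih =>
    intro k hk hin
    by_cases hi : i < p
    · simp [powerOrbit_of_lt M hi, hk]
    · obtain ⟨j, rfl⟩ := Nat.exists_eq_add_of_le' (not_lt.mp hi)
      have hjn : j < n := by omega
      rw [powerOrbit_add M hp, mulVec, dotProduct, Finset.sum_eq_single ⟨j, hjn⟩]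
      · exact mul_ne_zero (hM' _ _ hk (by omega)) (ih j (by omega) _ rfl (by omega))
      · intro l _ hl
        have hl' : (l : ℕ) ≠ j := fun h => hl (Fin.ext h)
        by_cases hlj : (l : ℕ) < j
        · rw [powerOrbit_apply_eq_zero hp hM j l hlj, mul_zero]
        · rw [hM k l (by omega), zero_mul]
      · simp

/-- A matrix supported on and below the `p`-th subdiagonal, whose `p`-th subdiagonal has no zero
except possibly the last entry, is the `p`-th power of a strictly lower triangular matrix. -/
lemma exists_pow_eq_of_subdiagonal_ne_zero {M : Matrix (Fin n) (Fin n) F} {p : ℕ} (hp : 0 < p)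
    (hM : ∀ i j : Fin n, (i : ℕ) < j + p → M i j = 0)
    (hM' : ∀ i j : Fin n, (i : ℕ) = j + p → (i : ℕ) + 1 < n → M i j ≠ 0) :
    ∃ N : Matrix (Fin n) (Fin n) F, (∀ i j, i ≤ j → N i j = 0) ∧ N ^ p = M := by
  let g := powerOrbit M p
  have hg := powerOrbit_apply_eq_zero hp hM
  let P : Matrix (Fin n) (Fin n) F :=
    of fun k i => if (i : ℕ) + 1 < n then g i k else if k = i then 1 else 0
  let Q : Matrix (Fin n) (Fin n) F := of fun k i => g (i + 1) k * if (i : ℕ) + 1 < n then 1 else 0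
  have hPlow : ∀ k i : Fin n, k < i → P k i = 0 := by
    intro k i hki
    simp only [P, of_apply]
    split_ifs with h1 h2
    · exact hg i k hki
    · exact absurd h2 hki.ne
    · rfl
  have hPtri : P.BlockTriangular OrderDual.toDual := fun k i hki => hPlow k i hki
  have hPdet : IsUnit P.det := by
    rw [det_of_isLowerTriangular P hPtri, isUnit_iff_ne_zero, Finset.prod_ne_zero_iff]
    intro i _
    simp only [P, of_apply]
    split_ifs with h1
    · exact powerOrbit_apply_self_ne_zero hp hM hM' i i rfl h1
    · exact one_ne_zero
  have : Invertible P := P.invertibleOfIsUnitDet hPdet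
  have hPinv : P⁻¹.BlockTriangular OrderDual.toDual :=
    blockTriangular_inv_of_blockTriangular hPtri
  have hNP : Q * P⁻¹ * P = Q := by rw [Matrix.mul_assoc, nonsing_inv_mul P hPdet, Matrix.mul_one]
  have hcol : ∀ (A : Matrix (Fin n) (Fin n) F) (i : Fin n), (A * P).col i = A *ᵥ P.col i :=
    fun A i => rfl
  have hPcol : ∀ i : Fin n, (i : ℕ) + 1 < n → P.col i = g i := by
    intro i hi
    ext k
    simp [P, hi]
  have hlast : ∀ i : Fin n, ¬ (i : ℕ) + 1 < n → (Q * P⁻¹) *ᵥ P.col i = 0 := by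
    intro i hi
    rw [← hcol (Q * P⁻¹) i, hNP]
    ext k
    simp [Q, hi]
  have hstep : ∀ i : ℕ, (Q * P⁻¹) *ᵥ g i = g (i + 1) := by
    intro i
    by_cases hi : i + 1 < n
    · have h := hcol (Q * P⁻¹) ⟨i, by omega⟩
      rw [hNP, hPcol _ hi] at h
      rw [← h]
      ext k
      simp [Q, hi]
    · have h0 : g (i + 1) = 0 := by
        ext k
        exact hg (i + 1) k (by omega)
      rw [h0]
      by_cases hin : i < n
      · have h1 : g i = g i ⟨i, hin⟩ • P.col ⟨i, hin⟩ := by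
          ext k
          by_cases hk : k = ⟨i, hin⟩
          · subst hk
            simp [P, hi]
          · have hk' : (k : ℕ) ≠ i := fun h => hk (Fin.ext h)
            have : g i k = 0 := hg i k (by omega)
            simp [P, hi, hk, this]
        rw [h1, mulVec_smul, hlast _ hi, smul_zero]
      · have h1 : g i = 0 := by
          ext k
          exact hg i k (by omega)
        rw [h1, mulVec_zero]
  have hiter : ∀ k i : ℕ, (Q * P⁻¹) ^ k *ᵥ g i = g (i + k) := by
    intro k
    induction k with
    | zero => simp
    | succ k ih =>
      intro i
      rw [pow_succ, ← mulVec_mulVec, hstep, ih]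
      congr 1
      omega
  refine ⟨Q * P⁻¹, ?_, ?_⟩
  · intro i j hij
    rw [Matrix.mul_apply]
    refine Finset.sum_eq_zero fun k _ => ?_
    by_cases hkj : k < j
    · rw [hPinv (show OrderDual.toDual j < OrderDual.toDual k from hkj), mul_zero]
    · have : g (k + 1) i = 0 := hg (k + 1) i (by
        have := Fin.le_def.mp (hij.trans (not_lt.mp hkj))
        omega)
      simp [Q, this]
  · have hmul : (Q * P⁻¹) ^ p * P = M * P := by
      refine Matrix.ext_col fun i => ?_
      rw [hcol, hcol]
      by_cases hi : (i : ℕ) + 1 < n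
      · rw [hPcol i hi, hiter, ← powerOrbit_add M hp]
      · obtain ⟨r, rfl⟩ := Nat.exists_eq_add_of_le' hp
        rw [pow_succ, ← mulVec_mulVec, hlast i hi, mulVec_zero]
        ext k
        simp only [mulVec, dotProduct, Pi.zero_apply]
        refine (Finset.sum_eq_zero fun l _ => ?_).symm
        by_cases hl : l = i
        · rw [hM k l (by subst hl; omega), zero_mul]
        · simp [P, hi, hl]
    have := congrArg (· * P⁻¹) hmul
    simpa [Matrix.mul_assoc, mul_nonsing_inv P hPdet] using this

/-- The variant of `exists_pow_eq_of_subdiagonal_ne_zero` in which the first entry of the `p`-th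
subdiagonal is the unrestricted one. -/
lemma exists_pow_eq_of_subdiagonal_ne_zero' {M : Matrix (Fin n) (Fin n) F} {p : ℕ} (hp : 0 < p)
    (hM : ∀ i j : Fin n, (i : ℕ) < j + p → M i j = 0)
    (hM' : ∀ i j : Fin n, (i : ℕ) = j + p → 0 < (j : ℕ) → M i j ≠ 0) :
    ∃ N : Matrix (Fin n) (Fin n) F, (∀ i j, i ≤ j → N i j = 0) ∧ N ^ p = M := by
  obtain ⟨N, hN, hNp⟩ := exists_pow_eq_of_subdiagonal_ne_zero (M := Mᵀ.submatrix Fin.rev Fin.rev)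
    hp (fun i j hij => hM _ _ (by simp only [Fin.val_rev]; omega))
    (fun i j hij hi => hM' _ _ (by simp only [Fin.val_rev]; omega)
      (by simp only [Fin.val_rev]; omega))
  have hpow : ∀ k : ℕ, (Nᵀ.submatrix Fin.rev Fin.rev) ^ k = (N ^ k)ᵀ.submatrix Fin.rev Fin.rev := by
    intro k
    rw [transpose_pow]
    exact (map_pow (reindexAlgEquiv F F (Fin.revPerm (n := n))) Nᵀ k).symm
  refine ⟨Nᵀ.submatrix Fin.rev Fin.rev, fun i j hij => hN _ _ (Fin.rev_le_rev.mpr hij), ?_⟩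
  rw [hpow, hNp]
  ext i j
  simp

lemma exists_isUnitriangular_pow_eq {p : ℕ} [Fact p.Prime] [CharP F p] (hn : 0 < n)
    {M : Matrix (Fin n) (Fin n) F}
    (hM : ∃ N : Matrix (Fin n) (Fin n) F, (∀ i j, i ≤ j → N i j = 0) ∧ N ^ p = M) :
    ∃ A : Matrix (Fin n) (Fin n) F, IsUnitriangular A ∧ A ^ p = 1 + M := by
  obtain ⟨N, hN, rfl⟩ := hM
  have : Nonempty (Fin n) := ⟨⟨0, hn⟩⟩
  refine ⟨1 + N, ⟨fun i => by simp [hN i i le_rfl], fun i j hij => ?_⟩, ?_⟩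
  · simp [hN i j hij.le, hij.ne]
  · rw [add_pow_char_of_commute p (Commute.one_left N), one_pow]

/-- The matrix whose `p`-th subdiagonal is `d` and whose other entries are zero. -/
def subdiagonal (p m : ℕ) (n : ℕ) (d : Fin m → F) : Matrix (Fin n) (Fin n) F :=
  of fun i j => if h : (i : ℕ) = j + p ∧ (j : ℕ) < m then d ⟨j, h.2⟩ else 0

lemma card_interior_ne_zero [Fintype F] [DecidableEq F] (r : ℕ) :
    (Finset.univ.filter fun d : Fin (r + 2) → F =>
      (∀ i, i ≠ 0 → i ≠ Fin.last _ → d i ≠ 0) ∧ (d 0 ≠ 0 ∨ d (Fin.last _) ≠ 0)).card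
      = (Fintype.card F - 1) ^ r * (Fintype.card F ^ 2 - 1) := by
  let A : Finset (Fin (r + 2) → F) := Fintype.piFinset fun i =>
    if i = 0 ∨ i = Fin.last _ then Finset.univ else Finset.univ.erase 0
  let B : Finset (Fin (r + 2) → F) := Fintype.piFinset fun i =>
    if i = 0 ∨ i = Fin.last _ then {0} else Finset.univ.erase 0
  have hprod : ∀ s : Finset F, (Fintype.piFinset fun i : Fin (r + 2) =>
      if i = 0 ∨ i = Fin.last _ then s else Finset.univ.erase 0).card
      = (Fintype.card F - 1) ^ r * s.card ^ 2 := by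
    intro s
    rw [Fintype.card_piFinset, Fin.prod_univ_succ, Fin.prod_univ_castSucc]
    have h : ∀ i : Fin r, ¬ ((i.castSucc.succ : Fin (r + 2)) = 0 ∨
        (i.castSucc.succ : Fin (r + 2)) = Fin.last _) := by
      intro i
      simp [Fin.ext_iff, i.isLt.ne]
    simp only [h, if_false, Fin.succ_last, true_or, or_true, if_true, Finset.prod_const,
      Finset.card_univ, Fintype.card_fin, Finset.card_erase_of_mem (Finset.mem_univ _)]
    ring
  have hBA : B ⊆ A := by
    refine Fintype.piFinset_subset _ _ fun i => ?_
    split_ifs <;> simp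
  have hAB : (Finset.univ.filter fun d : Fin (r + 2) → F =>
      (∀ i, i ≠ 0 → i ≠ Fin.last _ → d i ≠ 0) ∧ (d 0 ≠ 0 ∨ d (Fin.last _) ≠ 0)) = A \ B := by
    have hmem : ∀ (s : Finset F) (d : Fin (r + 2) → F), d ∈ (Fintype.piFinset fun i =>
        if i = 0 ∨ i = Fin.last _ then s else Finset.univ.erase 0) ↔
        (∀ i, i ≠ 0 → i ≠ Fin.last _ → d i ≠ 0) ∧ d 0 ∈ s ∧ d (Fin.last _) ∈ s := by
      intro s d
      rw [Fintype.mem_piFinset]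
      constructor
      · intro h
        refine ⟨fun i h0 h1 => ?_, by simpa using h 0, by simpa using h (Fin.last _)⟩
        simpa [h0, h1] using h i
      · rintro ⟨h, h0, h1⟩ i
        by_cases hi0 : i = 0
        · simpa [hi0] using h0
        by_cases hi1 : i = Fin.last _
        · simpa [hi1] using h1
        simpa [hi0, hi1] using h i hi0 hi1
    ext d
    rw [Finset.mem_sdiff, hmem, hmem]
    simp only [Finset.mem_filter, Finset.mem_univ, true_and, Finset.mem_singleton]
    tauto
  rw [hAB, Finset.card_sdiff_of_subset hBA, hprod, hprod, Finset.card_univ, Finset.card_singleton,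
    one_pow, Nat.mul_sub]

lemma pow_lt_three_mul_pow_mul {q r : ℕ} (hq : 2 ≤ q) (hr : r + 1 ≤ q) :
    q ^ (r + 2) < 3 * ((q - 1) ^ r * (q ^ 2 - 1)) := by
  rcases hq.eq_or_lt with rfl | hq
  · have : r < 2 := by omega
    interval_cases r <;> norm_num
  rcases (Nat.succ_le_of_lt hq).eq_or_lt with rfl | hq
  · have : r < 3 := by omega
    interval_cases r <;> norm_num
  obtain ⟨s, rfl⟩ : ∃ s, q = s + 1 := ⟨q - 1, by omega⟩
  have hs : (3 : ℝ) ≤ s := by exact_mod_cast (by omega : 3 ≤ s)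
  have hs0 : (0 : ℝ) < s := by linarith
  have hbound : ((s + 1 : ℝ) / s) ^ r < 2.7182818286 := by
    calc ((s + 1 : ℝ) / s) ^ r ≤ Real.exp (1 / s) ^ r := by
          gcongr
          rw [add_div, div_self hs0.ne', add_comm]
          exact Real.add_one_le_exp _
      _ = Real.exp (r * (1 / s)) := (Real.exp_nat_mul _ _).symm
      _ ≤ Real.exp 1 := by
          gcongr
          rw [mul_one_div, div_le_one hs0]
          exact_mod_cast (by omega : r ≤ s)
      _ < _ := Real.exp_one_lt_d9
  rw [div_pow, div_lt_iff₀ (by positivity)] at hbound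
  have hq2 : (s + 1 - 1) ^ r * ((s + 1) ^ 2 - 1) = s ^ r * (s ^ 2 + 2 * s) := by
    congr 1
    rw [Nat.sub_eq_iff_eq_add (by nlinarith)]
    ring
  rw [hq2]
  have hsr : (0 : ℝ) < s ^ r := by positivity
  suffices h : ((s : ℝ) + 1) ^ (r + 2) < 3 * (s ^ r * (s ^ 2 + 2 * s)) by exact_mod_cast h
  calc ((s : ℝ) + 1) ^ (r + 2) = (s + 1) ^ r * (s + 1) ^ 2 := pow_add _ _ _
    _ < 2.7182818286 * s ^ r * (s + 1) ^ 2 := mul_lt_mul_of_pos_right hbound (by positivity)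
    _ = s ^ r * (2.7182818286 * (s + 1) ^ 2) := by ring
    _ ≤ s ^ r * (3 * (s ^ 2 + 2 * s)) := by
        refine mul_le_mul_of_nonneg_left ?_ hsr.le
        nlinarith
    _ = _ := by ring

end pPowerPaper

theorem pPowerPaper.stmt4 (p e q : ℕ) (hp : p.Prime) (he : 0 < e) (hq : q = p ^ e)
    (F : Type*) [Field F] [Fintype F] (hF : Fintype.card F = q)
    (n : ℕ) (hn : p + 3 ≤ n) (hqn : n - p - 1 ≤ q) :
    (Set.ncard {B : Matrix (Fin n) (Fin n) F | ∃ A, IsUnitriangular A ∧ A ^ p = B} : ℝ)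
      > (1 / 3) * Set.ncard {B : Matrix (Fin n) (Fin n) F | MemUl (p - 1) B} := by
  classical
  have : Fact p.Prime := ⟨hp⟩
  have : CharP F p := charP_of_card_eq_prime_pow (hF.trans hq)
  have hp0 := hp.pos
  obtain ⟨r, rfl⟩ : ∃ r, n = p + (r + 2) := ⟨n - p - 2, by omega⟩
  let T : Set (Matrix (Fin (p + (r + 2))) (Fin (p + (r + 2))) F) := {B | MemUl p B}
  let D := Finset.univ.filter fun d : Fin (r + 2) → F =>
    (∀ i, i ≠ 0 → i ≠ Fin.last _ → d i ≠ 0) ∧ (d 0 ≠ 0 ∨ d (Fin.last _) ≠ 0)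
  let Φ : (Fin (r + 2) → F) × Matrix (Fin (p + (r + 2))) (Fin (p + (r + 2))) F →
      Matrix (Fin (p + (r + 2))) (Fin (p + (r + 2))) F :=
    fun x => subdiagonal p (r + 2) _ x.1 + x.2
  have hT0 : 0 < T.ncard := by
    rw [Set.ncard_pos]
    exact ⟨1, ⟨by simp, fun i j h => Matrix.one_apply_ne h.ne⟩,
      fun i j h _ => Matrix.one_apply_ne h.ne'⟩
  have hΦ : ∀ d B, B ∈ T → ∀ i j : Fin (p + (r + 2)), (hij : (i : ℕ) = j + p) →
      Φ (d, B) i j = d ⟨j, by omega⟩ := by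
    intro d B hB i j hij
    have hj : (j : ℕ) < r + 2 := by omega
    simp [Φ, subdiagonal, hij, hj, hB.2 i j (Fin.lt_def.mpr (by omega)) (by omega)]
  have hΦ' : ∀ d B, ∀ i j : Fin (p + (r + 2)), (i : ℕ) ≠ j + p → Φ (d, B) i j = B i j := by
    intro d B i j hij
    simp [Φ, subdiagonal, hij]
  have hupper : {B : Matrix (Fin (p + (r + 2))) (Fin (p + (r + 2))) F | MemUl (p - 1) B}.ncard
      ≤ q ^ (r + 2) * T.ncard := by
    have hsub : {B : Matrix (Fin (p + (r + 2))) (Fin (p + (r + 2))) F | MemUl (p - 1) B}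
        ⊆ Φ '' (Set.univ ×ˢ T) := by
      intro B hB
      let d : Fin (r + 2) → F := fun j => B ⟨j + p, by omega⟩ ⟨j, by omega⟩
      have hd : ∀ i j : Fin (p + (r + 2)), (i : ℕ) = j + p →
          subdiagonal p (r + 2) (p + (r + 2)) d i j = B i j := by
        intro i j hij
        have hj : (j : ℕ) < r + 2 := by omega
        have hi : i = ⟨j + p, hij ▸ i.isLt⟩ := Fin.ext hij
        rw [hi]
        simp [subdiagonal, d, hj]
      have hd' : ∀ i j : Fin (p + (r + 2)), (i : ℕ) ≠ j + p →
          subdiagonal p (r + 2) (p + (r + 2)) d i j = 0 := by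
        intro i j hij
        simp [subdiagonal, hij]
      have hR : MemUl p (B - subdiagonal p (r + 2) (p + (r + 2)) d) := by
        refine ⟨⟨?_, ?_⟩, ?_⟩
        · intro i
          rw [Matrix.sub_apply, hd' i i (by omega), hB.1.1, sub_zero]
        · intro i j hij
          rw [Matrix.sub_apply, hd' i j (by have := Fin.lt_def.mp hij; omega), hB.1.2 i j hij,
            sub_zero]
        · intro i j hji hij
          rw [Matrix.sub_apply]
          by_cases h : (i : ℕ) = j + p
          · rw [hd i j h, sub_self]
          · rw [hd' i j h, hB.2 i j hji (by omega), sub_zero]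
      exact ⟨(d, _), ⟨Set.mem_univ _, hR⟩, by simp [Φ]⟩
    calc _ ≤ (Φ '' (Set.univ ×ˢ T)).ncard := Set.ncard_le_ncard hsub
      _ ≤ ((Set.univ : Set (Fin (r + 2) → F)) ×ˢ T).ncard := Set.ncard_image_le
      _ = _ := by rw [Set.ncard_prod, Set.ncard_univ]; simp [hF]
  have hlower : (D : Set (Fin (r + 2) → F)).ncard * T.ncard ≤
      {B : Matrix (Fin (p + (r + 2))) (Fin (p + (r + 2))) F |
        ∃ A, IsUnitriangular A ∧ A ^ p = B}.ncard := by
    rw [← Set.ncard_prod, ← Set.InjOn.ncard_image (f := Φ)]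
    · refine Set.ncard_le_ncard ?_
      rintro _ ⟨⟨d, B⟩, ⟨hd, hB⟩, rfl⟩
      have hd : (∀ i, i ≠ 0 → i ≠ Fin.last _ → d i ≠ 0) ∧ (d 0 ≠ 0 ∨ d (Fin.last _) ≠ 0) := by
        simpa [D] using hd
      have hB : MemUl p B := hB
      have hzero : ∀ i j : Fin (p + (r + 2)), (i : ℕ) < j + p → (Φ (d, B) - 1) i j = 0 := by
        intro i j hij
        rw [Matrix.sub_apply, hΦ' d B i j hij.ne]
        rcases lt_trichotomy i j with h | rfl | h
        · rw [hB.1.2 i j h, Matrix.one_apply_ne h.ne, sub_zero]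
        · rw [hB.1.1, Matrix.one_apply_eq, sub_self]
        · rw [hB.2 i j h hij.le, Matrix.one_apply_ne h.ne', sub_zero]
      have hdiag : ∀ i j : Fin (p + (r + 2)), (hij : (i : ℕ) = j + p) →
          (Φ (d, B) - 1) i j = d ⟨j, by omega⟩ := by
        intro i j hij
        rw [Matrix.sub_apply, hΦ d B hB i j hij, Matrix.one_apply_ne (by
          rintro rfl
          omega), sub_zero]
      have hpow := exists_isUnitriangular_pow_eq (p := p) (M := Φ (d, B) - 1) (by omega) (by
        rcases hd.2 with h | h
        · refine exists_pow_eq_of_subdiagonal_ne_zero hp0 hzero fun i j hij hi => ?_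
          rw [hdiag i j hij]
          by_cases hj : (j : ℕ) = 0
          · simpa [hj] using h
          · exact hd.1 _ (fun h => hj (Fin.ext_iff.mp h)) fun h => by
              have := Fin.ext_iff.mp h
              rw [Fin.val_last] at this
              dsimp only at this
              omega
        · refine exists_pow_eq_of_subdiagonal_ne_zero' hp0 hzero fun i j hij hj => ?_
          rw [hdiag i j hij]
          by_cases hjl : (j : ℕ) = r + 1
          · have : (⟨j, by omega⟩ : Fin (r + 2)) = Fin.last _ := Fin.ext hjl
            rwa [this]
          · exact hd.1 _ (fun h => hj.ne' (Fin.ext_iff.mp h)) fun h => hjl (Fin.ext_iff.mp h))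
      rwa [add_sub_cancel] at hpow
    · rintro ⟨d, B⟩ ⟨-, hB⟩ ⟨d', B'⟩ ⟨-, hB'⟩ h
      have hdd : d = d' := by
        ext j
        rw [← hΦ d B hB ⟨j + p, by omega⟩ ⟨j, by omega⟩ rfl, h]
        exact hΦ d' B' hB' _ _ rfl
      subst hdd
      simpa [Φ] using h
  rw [Set.ncard_coe_finset, card_interior_ne_zero, hF] at hlower
  have hq2 : 2 ≤ q := by omega
  have hnum := pow_lt_three_mul_pow_mul hq2 (by omega : r + 1 ≤ q)
  have hlt := (Nat.mul_lt_mul_right hT0).mpr hnum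
  have key : {B : Matrix (Fin (p + (r + 2))) (Fin (p + (r + 2))) F | MemUl (p - 1) B}.ncard <
      3 * {B : Matrix (Fin (p + (r + 2))) (Fin (p + (r + 2))) F |
        ∃ A, IsUnitriangular A ∧ A ^ p = B}.ncard := by
    refine (hupper.trans_lt hlt).trans_le ?_
    rw [mul_assoc]
    exact Nat.mul_le_mul_left 3 hlower
  have key' := (Nat.cast_lt (α := ℝ)).mpr key
  push_cast at key'
  linarith
end

section
/- Let p be a prime, q a power of p, and n ≥ p+3 an integer. Set S = q^{(n−p)(n−p−1)/2}·(q−1)^{n−p} + Σ_{m=1}^{⌊(n−p)/2⌋} q^{(n−p)(n−p−1)/2 − m(m−1)/2}·2(q−1)^{n−p−m}. If n−p is even, then |U(n,q)^p| ≥ S. If n−p is odd, then |U(n,q)^p| ≥ S + q^{(n−p)(n−p−1)/2 − r(r−1)/2}·2(q−1)^{n−p−r}, where r = ⌊(n−p)/2⌋ + 1. -/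
namespace pPowerPaper

open Finset Matrix

section Nilpotent

variable {F : Type*} [Field F] {n : ℕ}

/-- A strictly lower triangular matrix shifts supports of vectors upwards. -/
lemma pow_mulVec_apply_eq_zero {N : Matrix (Fin n) (Fin n) F}
    (hN : ∀ i j : Fin n, i ≤ j → N i j = 0) {s : ℕ} {v : Fin n → F}
    (hv : ∀ i : Fin n, (i : ℕ) < s → v i = 0) (t : ℕ) :
    ∀ i : Fin n, (i : ℕ) < s + t → (N ^ t *ᵥ v) i = 0 := by
  induction t with
  | zero => simpa using hv
  | succ t ih =>
    intro i hi
    rw [pow_succ', ← mulVec_mulVec]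
    rw [mulVec, dotProduct]
    refine Finset.sum_eq_zero fun j _ => ?_
    rcases le_or_gt i j with h | h
    · rw [hN i j h, zero_mul]
    · rw [ih j (by have : (j : ℕ) < i := h; omega), mul_zero]

lemma exists_mulVec_eq {N : Matrix (Fin n) (Fin n) F}
    (hN : ∀ i j : Fin n, i ≤ j → N i j = 0) (s : ℕ)
    (hs : ∀ i j : Fin n, (i : ℕ) = j + 1 → s ≤ j → N i j ≠ 0)
    (w : Fin n → F) (hw : ∀ i : Fin n, (i : ℕ) < s + 1 → w i = 0) :
    ∃ v : Fin n → F, (∀ i : Fin n, (i : ℕ) < s → v i = 0) ∧ N *ᵥ v = w := by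
  induction hd : n - s generalizing s w with
  | zero =>
    refine ⟨0, fun _ _ => rfl, ?_⟩
    ext i
    rw [mulVec_zero, hw i (by omega), Pi.zero_apply]
  | succ d ih =>
    by_cases hsn : s + 1 < n
    · let a : Fin n := ⟨s, by omega⟩
      let b : Fin n := ⟨s + 1, hsn⟩
      have hba : N b a ≠ 0 := hs b a rfl le_rfl
      obtain ⟨v, hv, hvw⟩ := ih (s + 1) (fun i j h h' => hs i j h (by omega))
        (w - N *ᵥ Pi.single a (w b / N b a)) (fun i hi => by
          simp only [Pi.sub_apply, mulVec_single, Pi.smul_apply, MulOpposite.smul_eq_mul_unop,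
            MulOpposite.unop_op, col_apply]
          rcases Nat.lt_succ_iff_lt_or_eq.mp hi with h | h
          · rw [hw i h, hN i a (Nat.lt_succ_iff.mp h), zero_mul, sub_zero]
          · obtain rfl : i = b := Fin.ext h
            rw [mul_div_cancel₀ _ hba, sub_self]) (by omega)
      refine ⟨v + Pi.single a (w b / N b a), fun i hi => ?_, ?_⟩
      · have hia : i ≠ a := fun h => by rw [h] at hi; exact lt_irrefl _ hi
        rw [Pi.add_apply, hv i (by omega), Pi.single_eq_of_ne hia, add_zero]
      · rw [mulVec_add, hvw, sub_add_cancel]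
    · refine ⟨0, fun _ _ => rfl, ?_⟩
      ext i
      rw [mulVec_zero, hw i (by omega), Pi.zero_apply]

lemma exists_pow_mulVec_eq {N : Matrix (Fin n) (Fin n) F}
    (hN : ∀ i j : Fin n, i ≤ j → N i j = 0) (s : ℕ)
    (hs : ∀ i j : Fin n, (i : ℕ) = j + 1 → s ≤ j → N i j ≠ 0) (t : ℕ)
    (w : Fin n → F) (hw : ∀ i : Fin n, (i : ℕ) < s + t → w i = 0) :
    ∃ v : Fin n → F, (∀ i : Fin n, (i : ℕ) < s → v i = 0) ∧ N ^ t *ᵥ v = w := by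
  induction t generalizing w with
  | zero => exact ⟨w, hw, by simp⟩
  | succ t ih =>
    obtain ⟨u, hu, huw⟩ := exists_mulVec_eq hN (s + t)
      (fun i j h h' => hs i j h (by omega)) w hw
    obtain ⟨v, hv, hvu⟩ := ih u hu
    exact ⟨v, hv, by rw [pow_succ', ← mulVec_mulVec, hvu, huw]⟩

/-- The lower triangular bordering of `N` by a zero row and the column `v`. -/
def border (v : Fin n → F) (N : Matrix (Fin n) (Fin n) F) :
    Matrix (Fin (n + 1)) (Fin (n + 1)) F :=
  Matrix.of (Fin.cons 0 fun i => Fin.cons (v i) (N i))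

@[simp] lemma border_zero (v : Fin n → F) (N : Matrix (Fin n) (Fin n) F) (j : Fin (n + 1)) :
    border v N 0 j = 0 := rfl

@[simp] lemma border_succ_zero (v : Fin n → F) (N : Matrix (Fin n) (Fin n) F) (i : Fin n) :
    border v N i.succ 0 = v i := rfl

@[simp] lemma border_succ_succ (v : Fin n → F) (N : Matrix (Fin n) (Fin n) F) (i j : Fin n) :
    border v N i.succ j.succ = N i j := rfl

lemma border_mul_border (v w : Fin n → F) (N M : Matrix (Fin n) (Fin n) F) :
    border v N * border w M = border (N *ᵥ w) (N * M) := by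
  ext i j
  rw [mul_apply, Fin.sum_univ_succ]
  cases i using Fin.cases with
  | zero => simp
  | succ i =>
    cases j using Fin.cases with
    | zero => simp [mulVec, dotProduct]
    | succ j => simp [mul_apply]

lemma border_pow (v : Fin n → F) (N : Matrix (Fin n) (Fin n) F) (t : ℕ) :
    border v N ^ (t + 1) = border (N ^ t *ᵥ v) (N ^ (t + 1)) := by
  induction t with
  | zero => simp
  | succ t ih =>
    rw [pow_succ', ih, border_mul_border, mulVec_mulVec, ← pow_succ', ← pow_succ']

/-- A matrix supported on and below the `p`-th subdiagonal, whose `p`-th subdiagonal vanishes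
exactly in the first `m` columns and whose entries in these columns above row `m + p` vanish. -/
def IsBanded (p m : ℕ) (M : Matrix (Fin n) (Fin n) F) : Prop :=
  ∀ i j : Fin n, ((i : ℕ) < j + p ∨ ((j : ℕ) < m ∧ (i : ℕ) < m + p) → M i j = 0) ∧
    ((i : ℕ) = j + p → m ≤ j → M i j ≠ 0)

/-- Every banded matrix is the power of a strictly lower triangular matrix. -/
lemma IsBanded.exists_pow_eq {p m : ℕ} {M : Matrix (Fin n) (Fin n) F}
    (hM : IsBanded (p + 1) m M) :
    ∃ N : Matrix (Fin n) (Fin n) F, (∀ i j, i ≤ j → N i j = 0) ∧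
      (∀ i j : Fin n, (i : ℕ) = j + 1 → m ≤ j → N i j ≠ 0) ∧ N ^ (p + 1) = M := by
  induction n generalizing m with
  | zero => exact ⟨0, fun i => i.elim0, fun i => i.elim0, Subsingleton.elim _ _⟩
  | succ n ih =>
    obtain ⟨N, hN, hN1, hNM⟩ := ih (m := m - 1) (M := M.submatrix Fin.succ Fin.succ)
      (fun i j => by
        have h := hM i.succ j.succ
        simp only [Fin.val_succ] at h
        exact ⟨fun h' => h.1 (by omega), fun h1 h2 => h.2 (by omega) (by omega)⟩)
    obtain ⟨v, hv, hvw⟩ : ∃ v : Fin n → F,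
        (∀ i : Fin n, (i : ℕ) = 0 → m = 0 → v i ≠ 0) ∧
          N ^ p *ᵥ v = fun i => M i.succ 0 := by
      have hw : ∀ i : Fin n, (i : ℕ) < m - 1 + p → M i.succ 0 = 0 := fun i hi =>
        (hM i.succ 0).1 (by simp only [Fin.val_succ, Fin.val_zero]; omega)
      by_cases hc : m = 0 ∧ n ≤ p
      · refine ⟨1, fun _ _ _ => one_ne_zero, ?_⟩
        ext i
        rw [hw i (by omega)]
        exact pow_mulVec_apply_eq_zero hN (s := 0) (by simp) p i (by omega)
      · obtain ⟨v, -, hv⟩ := exists_pow_mulVec_eq hN (m - 1) hN1 p _ hw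
        refine ⟨v, fun i hi hm hvi => ?_, hv⟩
        have hpn : p < n := by omega
        have h0 := pow_mulVec_apply_eq_zero hN (s := 1) (v := v)
          (fun j hj => by rwa [show j = i from Fin.ext (by omega)]) p ⟨p, hpn⟩
          (by simp only; omega)
        rw [hv] at h0
        exact (hM (Fin.succ ⟨p, hpn⟩) 0).2 (by simp) (by simp [hm]) h0
    refine ⟨border v N, fun i j hij => ?_, fun i j hij hj => ?_, ?_⟩
    · cases i using Fin.cases with
      | zero => rfl
      | succ i =>
        cases j using Fin.cases with
        | zero => exact absurd hij (by simp)
        | succ j => exact hN i j (by simpa using hij)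
    · cases i using Fin.cases with
      | zero => simp at hij
      | succ i =>
        cases j using Fin.cases with
        | zero => exact hv i (by simpa using hij) (by simpa using hj)
        | succ j =>
          simp only [Fin.val_succ] at hij hj
          exact hN1 i j (by omega) (by omega)
    · rw [border_pow, hvw, hNM]
      ext i j
      cases i using Fin.cases with
      | zero => exact ((hM 0 j).1 (by simp)).symm
      | succ i =>
        cases j using Fin.cases with
        | zero => rfl
        | succ j => rfl

end Nilpotent

section Power

variable {F : Type*} {n : ℕ}

/-- Reflection of a matrix in the antidiagonal. -/
def antitranspose : Matrix (Fin n) (Fin n) F ≃ Matrix (Fin n) (Fin n) F where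
  toFun M := Matrix.of fun i j => M j.rev i.rev
  invFun M := Matrix.of fun i j => M j.rev i.rev
  left_inv M := by ext; simp
  right_inv M := by ext; simp

@[simp] lemma antitranspose_apply (M : Matrix (Fin n) (Fin n) F) (i j : Fin n) :
    antitranspose M i j = M j.rev i.rev := rfl

variable [Field F]

lemma IsBanded.exists_unitriangular {p m : ℕ} [Fact p.Prime] [CharP F p]
    {M : Matrix (Fin n) (Fin n) F} (hM : IsBanded p m M) :
    ∃ A, IsUnitriangular A ∧ A ^ p = 1 + M := by
  obtain ⟨r, rfl⟩ : ∃ r, p = r + 1 := ⟨p - 1, by have := (Fact.out : p.Prime).pos; omega⟩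
  obtain ⟨N, hN, -, rfl⟩ := hM.exists_pow_eq
  refine ⟨1 + N, ⟨fun i => by simp [hN i i le_rfl],
    fun i j h => by simp [one_apply_ne h.ne, hN i j h.le]⟩, ?_⟩
  rcases isEmpty_or_nonempty (Fin n) with h | h
  · exact Subsingleton.elim _ _
  · rw [add_pow_char_of_commute (p := r + 1) (Commute.one_left N), one_pow]

lemma antitranspose_mul (M N : Matrix (Fin n) (Fin n) F) :
    antitranspose (M * N) = antitranspose N * antitranspose M := by
  ext i j
  simp only [antitranspose_apply, mul_apply]
  rw [← Equiv.sum_comp Fin.revPerm]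
  simp [mul_comm]

lemma antitranspose_one : antitranspose (1 : Matrix (Fin n) (Fin n) F) = 1 := by
  ext i j
  simp [one_apply, eq_comm]

lemma antitranspose_pow (M : Matrix (Fin n) (Fin n) F) (t : ℕ) :
    antitranspose (M ^ t) = antitranspose M ^ t := by
  induction t with
  | zero => simp [antitranspose_one]
  | succ t ih => rw [pow_succ, antitranspose_mul, ih, pow_succ']

lemma antitranspose_add (M N : Matrix (Fin n) (Fin n) F) :
    antitranspose (M + N) = antitranspose M + antitranspose N := rfl

lemma IsBanded.exists_unitriangular_antitranspose {p m : ℕ} [Fact p.Prime] [CharP F p]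
    {M : Matrix (Fin n) (Fin n) F} (hM : IsBanded p m (antitranspose M)) :
    ∃ A, IsUnitriangular A ∧ A ^ p = 1 + M := by
  obtain ⟨A, hA, hAM⟩ := hM.exists_unitriangular
  refine ⟨antitranspose A, ⟨fun i => hA.1 _, fun i j h => hA.2 _ _ (Fin.rev_lt_rev.mpr h)⟩, ?_⟩
  rw [← antitranspose_pow, hAM, antitranspose_add, antitranspose_one]
  exact congrArg _ (antitranspose.symm_apply_apply M)

end Power

section Count

variable {F : Type*} [Field F] {n : ℕ}

lemma IsBanded.eq {p m m' : ℕ} {M : Matrix (Fin n) (Fin n) F} (hm : m + p < n)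
    (hm' : m' + p < n) (h : IsBanded p m M) (h' : IsBanded p m' M) : m = m' := by
  by_contra hne
  wlog hlt : m < m' generalizing m m'
  · exact this hm' hm h' h (Ne.symm hne) (by omega)
  · exact (h ⟨m + p, hm⟩ ⟨m, by omega⟩).2 rfl le_rfl
      ((h' ⟨m + p, hm⟩ ⟨m, by omega⟩).1 (Or.inr ⟨hlt, by simpa using hlt⟩))

lemma IsBanded.not_antitranspose {p m m' : ℕ} {M : Matrix (Fin n) (Fin n) F} (hm : m + p < n)
    (hm' : 0 < m') (h : IsBanded p m M) : ¬ IsBanded p m' (antitranspose M) := fun h' => by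
  have h1 := (h ⟨n - 1, by omega⟩ ⟨n - 1 - p, by omega⟩).2 (by simp only; omega)
    (by simp only; omega)
  have h2 := (h' ⟨p, by omega⟩ ⟨0, by omega⟩).1 (Or.inr ⟨hm', by simpa using hm'⟩)
  refine h1 ?_
  rw [antitranspose_apply] at h2
  convert h2 using 2
  · exact Fin.ext (by simp)
  · exact Fin.ext (by simp [Fin.val_rev]; omega)

variable [Fintype F] [DecidableEq F]

/-- The values allowed in row `i` and column `j` of a banded matrix. -/
def bandedEntries (F : Type*) [Field F] [Fintype F] [DecidableEq F] (p m i j : ℕ) : Finset F :=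
  if i < j + p ∨ (j < m ∧ i < m + p) then {0} else if i = j + p then {0}ᶜ else univ

/-- The finset of banded matrices. -/
def bandedMatrices (F : Type*) [Field F] [Fintype F] [DecidableEq F] (n p m : ℕ) :
    Finset (Matrix (Fin n) (Fin n) F) :=
  (Fintype.piFinset fun i : Fin n =>
    Fintype.piFinset fun j : Fin n => bandedEntries F p m i j).map Matrix.of.toEmbedding

lemma mem_bandedMatrices {p m : ℕ} {M : Matrix (Fin n) (Fin n) F} :
    M ∈ bandedMatrices F n p m ↔ IsBanded p m M := by
  simp only [bandedMatrices, mem_map_equiv, Fintype.mem_piFinset, IsBanded, of_symm_apply]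
  refine forall_congr' fun i => forall_congr' fun j => ?_
  unfold bandedEntries
  split_ifs with h1 h2
  · simp only [mem_singleton, h1, forall_const, iff_self_and]
    omega
  · rw [mem_compl, mem_singleton]
    exact ⟨fun h => ⟨fun h' => absurd h' h1, fun _ _ => h⟩, fun h => h.2 h2 (by omega)⟩
  · simp [h1, h2]

lemma card_bandedEntries (p m i j : ℕ) :
    #(bandedEntries F p m i j) = if i < j + p ∨ (j < m ∧ i < m + p) then 1 else
      if i = j + p then Fintype.card F - 1 else Fintype.card F := by
  unfold bandedEntries
  split_ifs <;> simp [card_compl]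

lemma prod_card_bandedEntries_left {p m a j : ℕ} (hj : j < m) :
    ∏ i ∈ range (m + a + p), #(bandedEntries F p m i j) = Fintype.card F ^ a := by
  rw [show m + a + p = m + p + a by ring, prod_range_add, prod_eq_one, one_mul]
  · rw [prod_congr rfl (g := fun _ => Fintype.card F), prod_const, card_range]
    intro i _
    rw [card_bandedEntries, if_neg (by omega), if_neg (by omega)]
  · intro i hi
    rw [card_bandedEntries, if_pos (Or.inr ⟨hj, mem_range.mp hi⟩)]

lemma prod_card_bandedEntries_middle {p m a b : ℕ} (hb : b < a) :
    ∏ i ∈ range (m + a + p), #(bandedEntries F p m i (m + b)) =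
      (Fintype.card F - 1) * Fintype.card F ^ (a - 1 - b) := by
  rw [show m + a + p = m + b + p + 1 + (a - 1 - b) by omega, prod_range_add, prod_range_succ,
    prod_eq_one, one_mul]
  · congr 1
    · rw [card_bandedEntries, if_neg (by omega), if_pos rfl]
    · rw [prod_congr rfl (g := fun _ => Fintype.card F), prod_const, card_range]
      intro i _
      rw [card_bandedEntries, if_neg (by omega), if_neg (by omega)]
  · intro i hi
    rw [card_bandedEntries, if_pos (Or.inl (mem_range.mp hi))]

lemma prod_card_bandedEntries_right {p m a b : ℕ} :
    ∏ i ∈ range (m + a + p), #(bandedEntries F p m i (m + a + b)) = 1 := by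
  refine prod_eq_one fun i hi => ?_
  rw [card_bandedEntries, if_pos (Or.inl (by have := mem_range.mp hi; omega))]

lemma card_bandedMatrices_add (p m a : ℕ) :
    #(bandedMatrices F (m + a + p) p m) =
      Fintype.card F ^ (m * a + a * (a - 1) / 2) * (Fintype.card F - 1) ^ a := by
  have h : #(bandedMatrices F (m + a + p) p m) =
      ∏ j ∈ range (m + a + p), ∏ i ∈ range (m + a + p), #(bandedEntries F p m i j) := by
    rw [bandedMatrices, card_map, Fintype.card_piFinset, prod_comm, prod_range]
    refine prod_congr rfl fun i _ => ?_
    rw [Fintype.card_piFinset, prod_range]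
  rw [h, prod_range_add, prod_range_add,
    prod_congr rfl (fun j hj => prod_card_bandedEntries_left (mem_range.mp hj)),
    prod_congr rfl (fun b hb => prod_card_bandedEntries_middle (mem_range.mp hb)),
    prod_congr rfl (fun b _ => prod_card_bandedEntries_right), prod_const_one, mul_one,
    prod_const, card_range, prod_mul_distrib, prod_const, card_range, prod_pow_eq_pow_sum,
    sum_range_reflect (fun b => b), sum_range_id, ← pow_mul, pow_add, mul_comm a m]
  ring

lemma half_mul_pred_add (m a : ℕ) :
    (m + a) * (m + a - 1) / 2 = m * a + a * (a - 1) / 2 + m * (m - 1) / 2 := by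
  simp only [← Nat.choose_two_right]
  rw [Nat.add_choose_eq, Nat.antidiagonal_succ]
  simp [Nat.antidiagonal_succ]
  ring

lemma card_bandedMatrices {p m : ℕ} (hm : m + p ≤ n) :
    #(bandedMatrices F n p m) =
      Fintype.card F ^ ((n - p) * (n - p - 1) / 2 - m * (m - 1) / 2) *
        (Fintype.card F - 1) ^ (n - p - m) := by
  obtain ⟨a, rfl⟩ : ∃ a, n = m + a + p := ⟨n - m - p, by omega⟩
  rw [card_bandedMatrices_add, Nat.add_sub_cancel, half_mul_pred_add, Nat.add_sub_cancel,
    Nat.add_sub_cancel_left]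

lemma le_ncard_pow {p : ℕ} [Fact p.Prime] [CharP F p] {L : ℕ} (hL : L + p < n) :
    Fintype.card F ^ ((n - p) * (n - p - 1) / 2) * (Fintype.card F - 1) ^ (n - p) +
        ∑ m ∈ Icc 1 L, Fintype.card F ^ ((n - p) * (n - p - 1) / 2 - m * (m - 1) / 2) *
          (2 * (Fintype.card F - 1) ^ (n - p - m))
      ≤ Set.ncard {B : Matrix (Fin n) (Fin n) F | ∃ A, IsUnitriangular A ∧ A ^ p = B} := by
  let T (m : ℕ) := bandedMatrices F n p m
  let T' (m : ℕ) := (T m).map antitranspose.toEmbedding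
  have hT' {m : ℕ} {M : Matrix (Fin n) (Fin n) F} (h : M ∈ T' m) :
      IsBanded p m (antitranspose M) :=
    mem_bandedMatrices.mp (mem_map_equiv.mp h)
  have hA : #((range (L + 1)).biUnion T) = ∑ m ∈ range (L + 1), #(T m) := by
    refine card_biUnion fun m hm m' hm' hne => disjoint_left.mpr fun M h h' => hne ?_
    rw [mem_coe, mem_range] at hm hm'
    exact (mem_bandedMatrices.mp h).eq (by omega) (by omega) (mem_bandedMatrices.mp h')
  have hB : #((Icc 1 L).biUnion T') = ∑ m ∈ Icc 1 L, #(T' m) := by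
    refine card_biUnion fun m hm m' hm' hne => disjoint_left.mpr fun M h h' => hne ?_
    rw [mem_coe, mem_Icc] at hm hm'
    exact (hT' h).eq (by omega) (by omega) (hT' h')
  have hAB : Disjoint ((range (L + 1)).biUnion T) ((Icc 1 L).biUnion T') := by
    refine disjoint_left.mpr fun M h h' => ?_
    obtain ⟨m, hm, h⟩ := mem_biUnion.mp h
    obtain ⟨m', hm', h'⟩ := mem_biUnion.mp h'
    rw [mem_range] at hm
    exact (mem_bandedMatrices.mp h).not_antitranspose (by omega) (mem_Icc.mp hm').1 (hT' h')
  let S := (range (L + 1)).biUnion T ∪ (Icc 1 L).biUnion T'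
  have hS : (S.map (addLeftEmbedding 1) : Set (Matrix (Fin n) (Fin n) F)) ⊆
      {B | ∃ A, IsUnitriangular A ∧ A ^ p = B} := by
    intro B hB
    obtain ⟨M, hM, rfl⟩ := mem_map.mp (mem_coe.mp hB)
    rcases mem_union.mp hM with h | h
    · obtain ⟨m, -, h⟩ := mem_biUnion.mp h
      exact (mem_bandedMatrices.mp h).exists_unitriangular
    · obtain ⟨m, -, h⟩ := mem_biUnion.mp h
      exact (hT' h).exists_unitriangular_antitranspose
  refine le_of_eq_of_le ?_ (Set.ncard_le_ncard hS (Set.toFinite _))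
  rw [Set.ncard_coe_finset, card_map, card_union_of_disjoint hAB, hA, hB, range_eq_Ico,
    sum_eq_sum_Ico_succ_bot (Nat.succ_pos L), add_assoc]
  have h0 : #(T 0) = _ := card_bandedMatrices (by omega)
  rw [h0, zero_add, Nat.succ_eq_add_one, Ico_add_one_right_eq_Icc, ← sum_add_distrib]
  congr 1
  refine sum_congr rfl fun m hm => ?_
  have hmL := (mem_Icc.mp hm).2
  rw [card_map, card_bandedMatrices (by omega)]
  ring

end Count

end pPowerPaper

theorem pPowerPaper.stmt5 (p e q : ℕ) (hp : p.Prime) (he : 0 < e) (hq : q = p ^ e)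
    (F : Type*) [Field F] [Fintype F] (hF : Fintype.card F = q)
    (n : ℕ) (hn : p + 3 ≤ n) :
    (Even (n - p) →
      q ^ ((n - p) * (n - p - 1) / 2) * (q - 1) ^ (n - p) +
        ∑ m ∈ Finset.Icc 1 ((n - p) / 2),
          q ^ ((n - p) * (n - p - 1) / 2 - m * (m - 1) / 2) * (2 * (q - 1) ^ (n - p - m))
      ≤ Set.ncard {B : Matrix (Fin n) (Fin n) F | ∃ A, IsUnitriangular A ∧ A ^ p = B}) ∧
    (Odd (n - p) →
      q ^ ((n - p) * (n - p - 1) / 2) * (q - 1) ^ (n - p) +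
        (∑ m ∈ Finset.Icc 1 ((n - p) / 2),
          q ^ ((n - p) * (n - p - 1) / 2 - m * (m - 1) / 2) * (2 * (q - 1) ^ (n - p - m))) +
        q ^ ((n - p) * (n - p - 1) / 2 - ((n - p) / 2 + 1) * ((n - p) / 2 + 1 - 1) / 2) *
          (2 * (q - 1) ^ (n - p - ((n - p) / 2 + 1)))
      ≤ Set.ncard {B : Matrix (Fin n) (Fin n) F | ∃ A, IsUnitriangular A ∧ A ^ p = B}) := by
  subst hq
  have : Fact p.Prime := ⟨hp⟩
  have : CharP F p := charP_of_card_eq_prime_pow hF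
  classical
  have h (L : ℕ) (hL : L + p < n) := pPowerPaper.le_ncard_pow (F := F) hL
  simp only [hF] at h
  refine ⟨fun _ => h _ (by omega), fun hodd => ?_⟩
  have hL := h ((n - p) / 2 + 1) (by omega)
  rwa [Finset.sum_Icc_succ_top (by omega), ← add_assoc] at hL
end

section
/- Let p be a prime, q a power of p, and n > p an integer. Let a_1, …, a_{n−p} ∈ F_q and suppose that either (i) there exists m ≥ 0 such that a_i = 0 for all i ≤ m and a_i ≠ 0 for all i > m, or (ii) there exists m such that a_i ≠ 0 for all i < m and a_i = 0 for all i ≥ m. Then the matrix I + Σ_{i=1}^{n−p} a_i e_{p+i,i} is a p-th power of an element of U(n,q), i.e., it lies in U(n,q)^p. -/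
/-- The matrix `I + ∑_{i=1}^{n-p} a_i e_{p+i,i}` (with `1`-based indices), where
`a t` (for `0 ≤ t < n - p`) encodes the paper's `a_{t+1}`. -/
def subdiagMatrix {F : Type*} [Field F] (n p : ℕ) (a : ℕ → F) :
    Matrix (Fin n) (Fin n) F :=
  fun i j => if i = j then 1 else if (i : ℕ) = (j : ℕ) + p then a (j : ℕ) else 0

open Finset

/-- The matrix with entries `b 0, b 1, …` on the first subdiagonal and zeros elsewhere. -/
def weightedShift {F : Type*} [Field F] (n : ℕ) (b : ℕ → F) : Matrix (Fin n) (Fin n) F :=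
  fun i j => if (i : ℕ) = (j : ℕ) + 1 then b (j : ℕ) else 0

theorem weightedShift_pow_apply {F : Type*} [Field F] (n : ℕ) (b : ℕ → F) (k : ℕ) (i j : Fin n) :
    (weightedShift n b ^ k) i j =
      if (i : ℕ) = (j : ℕ) + k then ∏ l ∈ range k, b (j + l) else 0 := by
  induction k generalizing i with
  | zero => simp [Matrix.one_apply, Fin.ext_iff]
  | succ k ih =>
    rw [pow_succ', Matrix.mul_apply]
    simp only [ih, weightedShift]
    by_cases h : (i : ℕ) = (j : ℕ) + (k + 1)
    · have hk : (j : ℕ) + k < n := by omega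
      rw [Finset.sum_eq_single ⟨(j : ℕ) + k, hk⟩]
      · rw [if_pos h, if_pos rfl, if_pos (by exact h), prod_range_succ, mul_comm]
      · intro x _ hx
        rw [if_neg (c := (x : ℕ) = j + k) fun hxk => hx (Fin.ext hxk), mul_zero]
      · simp
    · rw [if_neg h]
      refine Finset.sum_eq_zero fun x _ => ?_
      split_ifs <;> first | omega | simp

/-- A nowhere vanishing sequence in a field is the sequence of products of `r + 1` consecutive
terms of another nowhere vanishing sequence, up to any given length. -/
theorem exists_consecutive_prod_eq {F : Type*} [Field F] (r : ℕ) (a : ℕ → F)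
    (ha : ∀ t, a t ≠ 0) (N : ℕ) :
    ∃ b : ℕ → F, (∀ t, b t ≠ 0) ∧ ∀ t < N, ∏ l ∈ range (r + 1), b (t + l) = a t := by
  induction N with
  | zero => exact ⟨fun _ => 1, by simp, by simp⟩
  | succ N ih =>
    obtain ⟨b, hb, hprod⟩ := ih
    have hne : ∏ l ∈ range r, b (N + l) ≠ 0 := prod_ne_zero_iff.2 fun l _ => hb _
    refine ⟨Function.update b (N + r) (a N / ∏ l ∈ range r, b (N + l)), fun t => ?_,
      fun t ht => ?_⟩
    · rcases eq_or_ne t (N + r) with rfl | h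
      · rw [Function.update_self]
        exact div_ne_zero (ha N) hne
      · simpa [h] using hb t
    · rcases Nat.lt_succ_iff_lt_or_eq.1 ht with h | rfl
      · rw [← hprod t h]
        refine prod_congr rfl fun l hl => Function.update_of_ne ?_ _ _
        have := mem_range.1 hl
        omega
      · rw [prod_range_succ, Function.update_self, mul_div_assoc', div_eq_iff hne, mul_comm]
        refine congrArg _ (prod_congr rfl fun l hl => Function.update_of_ne ?_ _ _)
        have := mem_range.1 hl
        omega

/-- A finite sequence whose nonzero terms form a suffix or a prefix is the sequence of products
of `r + 1` consecutive terms of another sequence. -/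
theorem exists_consecutive_prod_eq_of_zeros {F : Type*} [Field F] (r N : ℕ) (a : ℕ → F)
    (ha : (∃ m : ℕ, ∀ t, t < N → (t < m → a t = 0) ∧ (m ≤ t → a t ≠ 0)) ∨
      (∃ m : ℕ, ∀ t, t < N → (t + 1 < m → a t ≠ 0) ∧ (m ≤ t + 1 → a t = 0))) :
    ∃ b : ℕ → F, ∀ t < N, ∏ l ∈ range (r + 1), b (t + l) = a t := by
  classical
  obtain ⟨b, -, hprod⟩ := exists_consecutive_prod_eq r (fun t => if a t = 0 then 1 else a t)
    (fun t => by split_ifs with h <;> simp [h]) N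
  rcases ha with ⟨m, hm⟩ | ⟨m, hm⟩
  · refine ⟨fun j => if j < m then 0 else b j, fun t ht => ?_⟩
    rcases lt_or_ge t m with h | h
    · rw [(hm t ht).1 h]
      exact prod_eq_zero (mem_range.2 r.succ_pos) (by simp [h])
    · have hat := hprod t ht
      rw [if_neg ((hm t ht).2 h)] at hat
      rw [← hat]
      exact prod_congr rfl fun l _ => if_neg (by omega)
  · refine ⟨fun j => if m + r ≤ j + 1 then 0 else b j, fun t ht => ?_⟩
    rcases lt_or_ge (t + 1) m with h | h
    · have hat := hprod t ht
      rw [if_neg ((hm t ht).1 h)] at hat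
      rw [← hat]
      exact prod_congr rfl fun l hl => if_neg (by have := mem_range.1 hl; omega)
    · rw [(hm t ht).2 h]
      exact prod_eq_zero (mem_range.2 r.lt_succ_self) (if_pos (by omega))

theorem pPowerPaper.stmt6 (p e : ℕ) (hp : p.Prime) (he : 0 < e)
    (F : Type*) [Field F] [Fintype F] (hF : Fintype.card F = p ^ e)
    (n : ℕ) (hn : p < n) (a : ℕ → F)
    (ha : (∃ m : ℕ, ∀ t, t < n - p → (t < m → a t = 0) ∧ (m ≤ t → a t ≠ 0)) ∨
          (∃ m : ℕ, ∀ t, t < n - p → (t + 1 < m → a t ≠ 0) ∧ (m ≤ t + 1 → a t = 0))) :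
    ∃ C : Matrix (Fin n) (Fin n) F, IsUnitriangular C ∧ C ^ p = subdiagMatrix n p a := by
  have : Fact p.Prime := ⟨hp⟩
  have : CharP F p := charP_of_card_eq_prime_pow hF
  have : NeZero n := ⟨by omega⟩
  obtain ⟨r, rfl⟩ := Nat.exists_eq_succ_of_ne_zero hp.ne_zero
  obtain ⟨b, hb⟩ := exists_consecutive_prod_eq_of_zeros r (n - (r + 1)) a ha
  refine ⟨1 + weightedShift n b, ⟨fun i => ?_, fun i j hij => ?_⟩, ?_⟩
  · simp [weightedShift]
  · have h : (i : ℕ) < j := hij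
    rw [Matrix.add_apply, Matrix.one_apply_ne hij.ne, weightedShift, if_neg (by omega), add_zero]
  · rw [add_pow_char_of_commute (p := r + 1) (Commute.one_left _), one_pow]
    ext i j
    rw [Matrix.add_apply, weightedShift_pow_apply, Matrix.one_apply, subdiagMatrix]
    by_cases hij : i = j
    · simp [hij]
    · rw [if_neg hij, if_neg hij, zero_add]
      refine if_ctx_congr Iff.rfl (fun h => hb j ?_) fun _ => rfl
      have := i.isLt
      omega
end

section
/- Let q be a prime power, n a positive integer, 0 ≤ l ≤ n−2, and ⌊(n−l−1)/2⌋ < m ≤ n−l. Let A = A(a_1, …, a_{n−l−1}) where a_i ≠ 0 for all i < m and a_i = 0 for all i ≥ m. Then the conjugacy class of A in U(n,q) has size exactly q^{(n−l−1)(n−l−2)/2 − (n−l−m)(n−l−m−1)/2}. Moreover, two distinct such matrices (for the same l and m) are not conjugate in U(n,q). -/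
/-- The matrix `A(a_1, …, a_{n-l-1}) = I + ∑_{i=1}^{n-l-1} a_i e_{l+1+i,i}` (with
`1`-based indices), where `a t` (for `0 ≤ t < n - l - 1`) encodes the paper's `a_{t+1}`. -/
def canonMatrix {F : Type*} [Field F] (n l : ℕ) (a : ℕ → F) :
    Matrix (Fin n) (Fin n) F :=
  fun i j => if i = j then 1 else if (i : ℕ) = (j : ℕ) + l + 1 then a (j : ℕ) else 0

open Matrix

namespace IsUnitriangular

variable {n : ℕ} {F : Type*} [Field F]

theorem one : IsUnitriangular (1 : Matrix (Fin n) (Fin n) F) :=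
  ⟨fun _ => one_apply_eq _, fun _ _ h => one_apply_ne h.ne⟩

theorem mul {A B : Matrix (Fin n) (Fin n) F} (hA : IsUnitriangular A) (hB : IsUnitriangular B) :
    IsUnitriangular (A * B) := by
  refine ⟨fun i => ?_, fun i j hij => ?_⟩
  · rw [mul_apply, Finset.sum_eq_single i, hA.1, hB.1, one_mul]
    · intro k _ hk
      rcases lt_or_gt_of_ne hk with h | h
      · rw [hB.2 k i h, mul_zero]
      · rw [hA.2 i k h, zero_mul]
    · simp
  · rw [mul_apply]
    refine Finset.sum_eq_zero fun k _ => ?_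
    rcases lt_or_ge i k with h | h
    · rw [hA.2 i k h, zero_mul]
    · rw [hB.2 k j (h.trans_lt hij), mul_zero]

theorem isUnit_det {A : Matrix (Fin n) (Fin n) F} (hA : IsUnitriangular A) : IsUnit A.det := by
  rw [det_of_isLowerTriangular A fun i j h => hA.2 i j h]
  simp [hA.1]

theorem add_sub {A B C : Matrix (Fin n) (Fin n) F} (hA : IsUnitriangular A)
    (hB : IsUnitriangular B) (hC : IsUnitriangular C) : IsUnitriangular (A + B - C) :=
  ⟨fun i => by simp [hA.1, hB.1, hC.1], fun i j h => by simp [hA.2 i j h, hB.2 i j h, hC.2 i j h]⟩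

/-- A left inverse exists because right multiplication is injective on a finite set. -/
theorem inv [Finite F] {A : Matrix (Fin n) (Fin n) F} (hA : IsUnitriangular A) :
    IsUnitriangular A⁻¹ := by
  let f : {B : Matrix (Fin n) (Fin n) F // IsUnitriangular B} →
      {B : Matrix (Fin n) (Fin n) F // IsUnitriangular B} := fun B => ⟨B * A, B.2.mul hA⟩
  have hf : Function.Injective f := by
    intro B C h
    have h' := congrArg (fun D => D.1 * A⁻¹) h
    simpa [f, mul_nonsing_inv_cancel_right _ _ hA.isUnit_det, Subtype.ext_iff] using h'
  obtain ⟨B, hB⟩ := Finite.surjective_of_injective hf ⟨1, one⟩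
  rw [inv_eq_left_inv (congrArg Subtype.val hB)]
  exact B.2

end IsUnitriangular

theorem Finset.card_image_mul_of_card_fiber {α β : Type*} [DecidableEq β] (s : Finset α)
    (f : α → β) (z : ℕ) (h : ∀ x ∈ s, {y ∈ s | f y = f x}.card = z) :
    (s.image f).card * z = s.card := by
  rw [card_eq_sum_card_image f s, sum_const_nat]
  intro b hb
  obtain ⟨x, hx, rfl⟩ := mem_image.1 hb
  exact h x hx

/-- A conjugacy class under the unitriangular group has as many elements as there are commutators
`A * C - C * A`, since both maps have fibres of the size of the centralizer. -/
theorem ncard_unitriangular_conj {n : ℕ} {F : Type*} [Field F] [Finite F]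
    (A : Matrix (Fin n) (Fin n) F) :
    ((fun C => C⁻¹ * A * C) '' {C | IsUnitriangular C}).ncard =
      ((fun C => A * C - C * A) '' {C | IsUnitriangular C}).ncard := by
  classical
  have := Fintype.ofFinite F
  set U : Finset (Matrix (Fin n) (Fin n) F) := {C | IsUnitriangular C} with hU
  have hUc : {C : Matrix (Fin n) (Fin n) F | IsUnitriangular C} = U := by simp [hU]
  have memU : ∀ {C}, C ∈ U ↔ IsUnitriangular C := by simp [hU]
  have hconj : ∀ x ∈ U, {y ∈ U | y⁻¹ * A * y = x⁻¹ * A * x}.card = {y ∈ U | A * y = y * A}.card := by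
    intro x hx
    rw [memU] at hx
    have hxd := hx.isUnit_det
    refine Finset.card_bij' (fun y _ => y * x⁻¹) (fun y _ => y * x) ?_ ?_ ?_ ?_
    · intro y hy
      rw [Finset.mem_filter, memU] at hy ⊢
      refine ⟨hy.1.mul hx.inv, ?_⟩
      have h := congrArg (fun D => y * D * x⁻¹) hy.2
      simpa [← Matrix.mul_assoc, mul_nonsing_inv_cancel_right _ _ hxd,
        mul_nonsing_inv _ hy.1.isUnit_det] using h
    · intro y hy
      rw [Finset.mem_filter, memU] at hy ⊢
      refine ⟨hy.1.mul hx, ?_⟩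
      rw [Matrix.mul_inv_rev, ← Matrix.mul_assoc, Matrix.mul_assoc _ A y, Matrix.mul_assoc _ y⁻¹,
        hy.2, nonsing_inv_mul_cancel_left _ _ hy.1.isUnit_det]
    · intro y _
      exact nonsing_inv_mul_cancel_right _ _ hxd
    · intro y _
      exact mul_nonsing_inv_cancel_right _ _ hxd
  have hcomm : ∀ x ∈ U, {y ∈ U | A * y - y * A = A * x - x * A}.card =
      {y ∈ U | A * y = y * A}.card := by
    intro x hx
    rw [memU] at hx
    refine Finset.card_bij' (fun y _ => y + 1 - x) (fun y _ => y + x - 1) ?_ ?_ ?_ ?_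
    · intro y hy
      rw [Finset.mem_filter, memU] at hy ⊢
      refine ⟨hy.1.add_sub .one hx, ?_⟩
      rw [← sub_eq_zero] at hy ⊢
      rw [← hy.2]
      noncomm_ring
    · intro y hy
      rw [Finset.mem_filter, memU] at hy ⊢
      refine ⟨hy.1.add_sub hx .one, ?_⟩
      have h := hy.2
      rw [← sub_eq_zero] at h ⊢
      rw [← h]
      noncomm_ring
    · intro y _
      abel
    · intro y _
      abel
  rw [hUc, ← Finset.coe_image, ← Finset.coe_image, Set.ncard_coe_finset, Set.ncard_coe_finset]
  refine Nat.eq_of_mul_eq_mul_right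
    (Finset.card_pos.2 ⟨1, Finset.mem_filter.2 ⟨memU.2 .one, by simp⟩⟩)
    ((Finset.card_image_mul_of_card_fiber U _ _ hconj).trans
      (Finset.card_image_mul_of_card_fiber U _ _ hcomm).symm)

section canonMatrix

variable {F : Type*} [Field F] {n : ℕ}

theorem canonMatrix_mul_apply (l : ℕ) (a : ℕ → F) (C : Matrix (Fin n) (Fin n) F) (i j : Fin n) :
    (canonMatrix n l a * C) i j = C i j +
      if l + 1 ≤ (i : ℕ) then a (i - (l + 1)) * C ⟨i - (l + 1), by omega⟩ j else 0 := by
  have h : ∀ k, canonMatrix n l a i k * C k j = (if i = k then C k j else 0) +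
      if (i : ℕ) = k + l + 1 then a k * C k j else 0 := by
    intro k
    unfold canonMatrix
    split_ifs with h1 h2 <;> simp
    omega
  rw [mul_apply, Finset.sum_congr rfl fun k _ => h k, Finset.sum_add_distrib]
  congr 1
  · simp
  split_ifs with hi
  · rw [Finset.sum_eq_single ⟨i - (l + 1), by omega⟩, if_pos (by simp; omega)]
    · intro k _ hk
      exact if_neg fun h => hk (Fin.ext (by simp; omega))
    · simp
  · exact Finset.sum_eq_zero fun k _ => if_neg (by omega)

theorem mul_canonMatrix_apply (l : ℕ) (a : ℕ → F) (C : Matrix (Fin n) (Fin n) F) (i j : Fin n) :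
    (C * canonMatrix n l a) i j = C i j +
      if h : (j : ℕ) + (l + 1) < n then C i ⟨j + (l + 1), h⟩ * a j else 0 := by
  have h : ∀ k, C i k * canonMatrix n l a k j = (if k = j then C i k else 0) +
      if (k : ℕ) = j + l + 1 then C i k * a j else 0 := by
    intro k
    unfold canonMatrix
    split_ifs with h1 h2 <;> simp
    omega
  rw [mul_apply, Finset.sum_congr rfl fun k _ => h k, Finset.sum_add_distrib]
  congr 1
  · simp
  split_ifs with hj
  · rw [Finset.sum_eq_single ⟨j + (l + 1), hj⟩, if_pos (by simp; omega)]
    · intro k _ hk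
      exact if_neg fun h => hk (Fin.ext (by simp; omega))
    · simp
  · exact Finset.sum_eq_zero fun k _ => if_neg (by omega)

/-- The solution of the recursion along diagonals which expresses that `M` is a commutator of
`canonMatrix n l a`. -/
def commutatorPreimage (l k : ℕ) (a : ℕ → F) (M : ℕ → ℕ → F) (i j : ℕ) : F :=
  if i = j then 1 else
  if l + 1 ≤ j ∧ j < i ∧ j - (l + 1) < k then
    (a (i - (l + 1)) * commutatorPreimage l k a M (i - (l + 1)) (j - (l + 1)) -
      M i (j - (l + 1))) / a (j - (l + 1))
  else 0
termination_by i

theorem image_commutator_canonMatrix (l k : ℕ) (a : ℕ → F)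
    (ha0 : ∀ t < k, a t ≠ 0) (ha1 : ∀ t, k ≤ t → t < n - l - 1 → a t = 0) :
    (fun C => canonMatrix n l a * C - C * canonMatrix n l a) '' {C | IsUnitriangular C} =
      {M | ∀ i j : Fin n, ¬ ((j : ℕ) + (l + 1) < i ∧ (j : ℕ) < k) → M i j = 0} := by
  have hzero : ∀ C : Matrix (Fin n) (Fin n) F, IsUnitriangular C → ∀ i j : Fin n,
      ¬ ((j : ℕ) + (l + 1) < i ∧ (j : ℕ) < k) → (canonMatrix n l a * C - C * canonMatrix n l a) i j = 0 := by
    intro C hC i j hij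
    rw [Matrix.sub_apply, canonMatrix_mul_apply, mul_canonMatrix_apply, add_sub_add_left_eq_sub]
    obtain h | h | ⟨h, hj⟩ : (i : ℕ) < j + (l + 1) ∨ (i : ℕ) = j + (l + 1) ∨
        ((j : ℕ) + (l + 1) < i ∧ k ≤ j) := by omega
    · have h1 : ∀ hi, l + 1 ≤ (i : ℕ) → C ⟨i - (l + 1), hi⟩ j = 0 := fun hi hl =>
        hC.2 _ _ (Fin.lt_def.2 (by simp only; omega))
      have h2 : ∀ hj, C i ⟨j + (l + 1), hj⟩ = 0 := fun hj => hC.2 _ _ (Fin.lt_def.2 h)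
      split_ifs with h3 h4 h4 <;> simp_all
    · have e1 : (⟨i - (l + 1), by omega⟩ : Fin n) = j := Fin.ext (by simp only; omega)
      have e2 : (⟨j + (l + 1), by omega⟩ : Fin n) = i := Fin.ext h.symm
      have e3 : (i : ℕ) - (l + 1) = j := by omega
      rw [if_pos (by omega), dif_pos (by omega), e1, e2, e3, hC.1, hC.1, one_mul, mul_one, sub_self]
    · rw [if_pos (by omega), dif_pos (by omega), ha1 j hj (by omega),
        ha1 (i - (l + 1)) (by omega) (by omega)]
      simp
  refine Set.Subset.antisymm (Set.image_subset_iff.2 fun C hC => hzero C hC) fun M hM => ?_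
  let M' : ℕ → ℕ → F := fun i j => if h : i < n ∧ j < n then M ⟨i, h.1⟩ ⟨j, h.2⟩ else 0
  let C : Matrix (Fin n) (Fin n) F := fun i j => commutatorPreimage l k a M' i j
  have hC : IsUnitriangular C := by
    refine ⟨fun i => ?_, fun i j hij => ?_⟩
    · simp only [C]
      rw [commutatorPreimage, if_pos rfl]
    · have : (i : ℕ) < j := hij
      simp only [C]
      rw [commutatorPreimage, if_neg (by omega), if_neg (by omega)]
  refine ⟨C, hC, Matrix.ext fun i j => ?_⟩
  by_cases hij : (j : ℕ) + (l + 1) < i ∧ (j : ℕ) < k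
  · have hrec : C i ⟨j + (l + 1), by omega⟩ =
        (a (i - (l + 1)) * C ⟨i - (l + 1), by omega⟩ j - M i j) / a j := by
      simp only [C]
      rw [commutatorPreimage, if_neg (by omega), if_pos (by omega), Nat.add_sub_cancel]
      simp [M']
    dsimp only
    rw [Matrix.sub_apply, canonMatrix_mul_apply, mul_canonMatrix_apply, add_sub_add_left_eq_sub,
      if_pos (by omega), dif_pos (by omega), hrec, div_mul_cancel₀ _ (ha0 j hij.2), sub_sub_cancel]
  · exact (hzero C hC i j hij).trans (hM i j hij).symm

theorem ncard_supported [Fintype F] (P : Fin n → Fin n → Prop) [∀ i j, Decidable (P i j)] :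
    {M : Matrix (Fin n) (Fin n) F | ∀ i j, ¬ P i j → M i j = 0}.ncard =
      Fintype.card F ^ Fintype.card {p : Fin n × Fin n // P p.1 p.2} := by
  rw [← Nat.card_coe_set_eq, ← Fintype.card_fun, ← Nat.card_eq_fintype_card]
  refine Nat.card_congr
    { toFun := fun M p => M.1 p.1.1 p.1.2
      invFun := fun f => ⟨fun i j => if h : P i j then f ⟨(i, j), h⟩ else 0, fun i j h => dif_neg h⟩
      left_inv := fun M => ?_
      right_inv := fun f => ?_ }
  · ext i j
    by_cases h : P i j
    · simp [h]
    · simp [h, M.2 i j h]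
  · ext ⟨⟨i, j⟩, h⟩
    exact dif_pos h

end canonMatrix

theorem sum_range_sub_add_choose_two {N k : ℕ} (hk : k ≤ N) :
    ∑ j ∈ Finset.range k, (N - 1 - j) + (N - k).choose 2 = N.choose 2 := by
  induction k with
  | zero => simp
  | succ k ih =>
    obtain ⟨r, rfl⟩ := Nat.exists_eq_add_of_le hk
    have h : (r + 1).choose 2 = r + r.choose 2 := by
      rw [Nat.choose_succ_succ' r 1, Nat.choose_one_right]
    rw [← ih (by omega), Finset.sum_range_succ, show k + 1 + r - k = r + 1 by omega, h,
      Nat.add_sub_cancel_left, show k + 1 + r - 1 - k = r by omega, add_assoc]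

theorem card_fin_pairs (n l k : ℕ) (hk : k ≤ n - l - 1) :
    Fintype.card {p : Fin n × Fin n // (p.2 : ℕ) + (l + 1) < p.1 ∧ (p.2 : ℕ) < k} =
      (n - l - 1) * (n - l - 2) / 2 - (n - l - (k + 1)) * (n - l - (k + 1) - 1) / 2 := by
  have e : {p : Fin n × Fin n // (p.2 : ℕ) + (l + 1) < p.1 ∧ (p.2 : ℕ) < k} ≃
      (j : Fin k) × Fin (n - l - 1 - 1 - j) :=
    { toFun := fun p => ⟨⟨p.1.2, p.2.2⟩, ⟨p.1.1 - (p.1.2 + (l + 2)), by have := p.2; grind⟩⟩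
      invFun := fun x => ⟨(⟨x.2 + (x.1 + (l + 2)), by omega⟩, ⟨x.1, by omega⟩),
        by simp only; omega, x.1.2⟩
      left_inv := fun p => by
        ext
        · simp only
          have := p.2.1
          omega
        · rfl
      right_inv := fun x => by simp }
  rw [Fintype.card_congr e, Fintype.card_sigma]
  simp only [Fintype.card_fin]
  rw [Fin.sum_univ_eq_sum_range fun j => n - l - 1 - 1 - j]
  have h := sum_range_sub_add_choose_two hk
  rw [Nat.choose_two_right, Nat.choose_two_right] at h
  rw [show n - l - 2 = n - l - 1 - 1 by omega, ← h, show n - l - (k + 1) = n - l - 1 - k by omega,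
    Nat.add_sub_cancel]

theorem pPowerPaper.stmt9 (q : ℕ) (F : Type*) [Field F] [Fintype F] (hF : Fintype.card F = q)
    (n l m : ℕ) (hn : 0 < n) (hl : l ≤ n - 2)
    (hm1 : (n - l - 1) / 2 < m) (hm2 : m ≤ n - l)
    (a : ℕ → F) (ha : ∀ t, t < n - l - 1 → (t + 1 < m → a t ≠ 0) ∧ (m ≤ t + 1 → a t = 0)) :
    Set.ncard {B : Matrix (Fin n) (Fin n) F |
        ∃ C, IsUnitriangular C ∧ C⁻¹ * canonMatrix n l a * C = B}
      = q ^ ((n - l - 1) * (n - l - 2) / 2 - (n - l - m) * (n - l - m - 1) / 2) ∧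
    ∀ a' : ℕ → F, (∀ t, t < n - l - 1 → (t + 1 < m → a' t ≠ 0) ∧ (m ≤ t + 1 → a' t = 0)) →
      canonMatrix n l a ≠ canonMatrix n l a' →
      ¬ ∃ C : Matrix (Fin n) (Fin n) F,
          IsUnitriangular C ∧ C⁻¹ * canonMatrix n l a * C = canonMatrix n l a' := by
  constructor
  · obtain ⟨k, rfl⟩ : ∃ k, m = k + 1 := ⟨m - 1, by omega⟩
    have hk : k ≤ n - l - 1 := by omega
    have h := ncard_unitriangular_conj (canonMatrix n l a)
    rw [image_commutator_canonMatrix l k a (fun t ht => (ha t (by omega)).1 (by omega))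
      (fun t ht ht' => (ha t ht').2 (by omega)),
      ncard_supported fun i j : Fin n => (j : ℕ) + (l + 1) < i ∧ (j : ℕ) < k,
      card_fin_pairs n l k hk, hF] at h
    exact h
  · rintro a' - hne ⟨C, hC, h⟩
    have hcomm : canonMatrix n l a * C = C * canonMatrix n l a' := by
      rw [← h, Matrix.mul_assoc, mul_nonsing_inv_cancel_left _ _ hC.isUnit_det]
    refine hne (Matrix.ext fun i j => ?_)
    unfold canonMatrix
    split_ifs with h1 h2
    · rfl
    · have e := congrFun (congrFun hcomm i) j
      have e1 : (⟨i - (l + 1), by omega⟩ : Fin n) = j := Fin.ext (by simp only; omega)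
      have e2 : (⟨j + (l + 1), by omega⟩ : Fin n) = i := Fin.ext (by simp only; omega)
      have e3 : (i : ℕ) - (l + 1) = j := by omega
      rw [canonMatrix_mul_apply, mul_canonMatrix_apply, if_pos (by omega), dif_pos (by omega),
        e1, e2, e3, hC.1, hC.1, one_mul, mul_one] at e
      exact add_left_cancel e
    · rfl
end

section
/- Let q be a prime power and n a positive integer. If d, d' ∈ D(n,q) are invertible diagonal matrices of the same type, then the centralizers C_{U(n,q)}(d) and C_{U(n,q)}(d') are isomorphic as groups. -/
/-- The type of an invertible diagonal matrix, encoded by its diagonal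
`d : Fin n → F`: the multiset of the sizes of the fibers of `d`. -/
def typeMultiset {n : ℕ} {F : Type*} [DecidableEq F] (d : Fin n → F) : Multiset ℕ :=
  (Finset.image d Finset.univ).val.map fun c => (Finset.univ.filter fun i => d i = c).card

/-- The centralizer of the diagonal matrix with diagonal `d` inside the group of
lower unitriangular matrices, as a set of matrices. -/
def centralizerU {n : ℕ} {F : Type*} [Field F] (d : Fin n → F) :
    Set (Matrix (Fin n) (Fin n) F) :=
  {u | IsUnitriangular u ∧ u * Matrix.diagonal d = Matrix.diagonal d * u}

/-- Two finitely indexed families with the same multiset of values differ by a bijection of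
their index types. -/
theorem exists_equiv_of_map_univ_eq {α β γ : Type*} [Fintype α] [Fintype β] [DecidableEq γ]
    {f : α → γ} {g : β → γ}
    (h : (Finset.univ : Finset α).val.map f = (Finset.univ : Finset β).val.map g) :
    ∃ e : α ≃ β, ∀ a, g (e a) = f a := by
  have card_fiber (c : γ) : Fintype.card {a // f a = c} = Fintype.card {b // g b = c} := by
    have hc := congrArg (Multiset.count c) h
    rw [Multiset.count_map, Multiset.count_map] at hc
    rw [Fintype.card_subtype, Fintype.card_subtype]
    simp only [eq_comm (a := c)] at hc
    exact hc
  exact ⟨Equiv.ofFiberEquiv fun c => Fintype.equivOfCardEq (card_fiber c),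
    fun a => Equiv.ofFiberEquiv_map _ a⟩

/-- Two colourings of a finite linear order by the same colours, with equal fiber sizes, differ by
a permutation that is monotone on every fiber. -/
theorem exists_perm_strictMono_on_fibers {α γ : Type*} [LinearOrder α] [Fintype α] [DecidableEq γ]
    {f g : α → γ} (h : ∀ c, Fintype.card {a // f a = c} = Fintype.card {a // g a = c}) :
    ∃ σ : Equiv.Perm α, (∀ a, g (σ a) = f a) ∧ ∀ a b, f a = f b → (σ a < σ b ↔ a < b) := by
  let E (c : γ) : {a // f a = c} ≃o {a // g a = c} :=
    (Fintype.orderIsoFinOfCardEq _ (h c)).symm.trans (Fintype.orderIsoFinOfCardEq _ rfl)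
  have hE (a : α) (c : γ) (hc : f a = c) :
      Equiv.ofFiberEquiv (fun c => (E c).toEquiv) a = (E c ⟨a, hc⟩ : α) := by
    subst hc
    rfl
  refine ⟨Equiv.ofFiberEquiv fun c => (E c).toEquiv,
    fun a => Equiv.ofFiberEquiv_map _ a, fun a b hab => ?_⟩
  rw [hE a _ hab, hE b _ rfl, Subtype.coe_lt_coe, OrderIso.lt_iff_lt, Subtype.mk_lt_mk]

/-- Diagonals of the same type have matching fibers, via a permutation that is monotone on
every fiber. -/
theorem exists_perm_of_typeMultiset_eq {n : ℕ} {F : Type*} [DecidableEq F] {d d' : Fin n → F}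
    (htype : typeMultiset d = typeMultiset d') :
    ∃ σ : Equiv.Perm (Fin n), (∀ i j, d' (σ i) = d' (σ j) ↔ d i = d j) ∧
      ∀ i j, d i = d j → (σ i < σ j ↔ i < j) := by
  let color (d : Fin n → F) (i : Fin n) : {c // c ∈ Finset.univ.image d} :=
    ⟨d i, Finset.mem_image_of_mem d (Finset.mem_univ i)⟩
  have color_eq (d : Fin n → F) (i j : Fin n) : color d i = color d j ↔ d i = d j :=
    Subtype.mk_eq_mk
  have type_eq (d : Fin n → F) : typeMultiset d =
      (Finset.univ : Finset {c // c ∈ Finset.univ.image d}).val.map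
        fun c => Fintype.card {i // color d i = c} := by
    have hcard (c : {c // c ∈ Finset.univ.image d}) : Fintype.card {i // color d i = c} =
        (Finset.univ.filter fun i => d i = c).card := by
      rw [Fintype.card_subtype]
      simp only [color, Subtype.ext_iff]
    simp only [hcard]
    exact (Multiset.attach_map_val' _
      (fun c => (Finset.univ.filter fun i => d i = c).card)).symm
  rw [type_eq, type_eq] at htype
  obtain ⟨e, he⟩ := exists_equiv_of_map_univ_eq htype
  obtain ⟨σ, hσ, hmono⟩ := exists_perm_strictMono_on_fibers
    (f := fun i => e (color d i)) (g := color d') fun c => by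
      rw [← e.apply_symm_apply c, he]
      exact Fintype.card_congr (Equiv.subtypeEquivRight fun i => e.apply_eq_iff_eq)
  refine ⟨σ, fun i j => ?_, fun i j hij => hmono i j (congrArg e ((color_eq d i j).2 hij))⟩
  rw [← color_eq d', hσ, hσ, e.apply_eq_iff_eq, color_eq]

theorem mem_centralizerU_iff {n : ℕ} {F : Type*} [Field F] {d : Fin n → F}
    {u : Matrix (Fin n) (Fin n) F} :
    u ∈ centralizerU d ↔ IsUnitriangular u ∧ ∀ i j, d i ≠ d j → u i j = 0 := by
  refine and_congr_right fun _ => ?_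
  rw [← Matrix.ext_iff]
  refine forall₂_congr fun i j => ?_
  rw [Matrix.mul_diagonal, Matrix.diagonal_mul, mul_comm, mul_eq_mul_right_iff, eq_comm,
    or_iff_not_imp_left]

theorem submatrix_mem_centralizerU {n : ℕ} {F : Type*} [Field F] {d d' : Fin n → F}
    {σ : Equiv.Perm (Fin n)} (hσ : ∀ i j, d' (σ i) = d' (σ j) ↔ d i = d j)
    (hmono : ∀ i j, d i = d j → (σ i < σ j ↔ i < j)) {u : Matrix (Fin n) (Fin n) F}
    (hu : u ∈ centralizerU d') : u.submatrix σ σ ∈ centralizerU d := by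
  rw [mem_centralizerU_iff] at hu ⊢
  obtain ⟨⟨hdiag, hupper⟩, hzero⟩ := hu
  refine ⟨⟨fun i => hdiag _, fun i j hij => ?_⟩, fun i j hij => hzero _ _ (mt (hσ i j).1 hij)⟩
  by_cases h : d i = d j
  · exact hupper _ _ ((hmono i j h).2 hij)
  · exact hzero _ _ (mt (hσ i j).1 h)

/-- If `d, d'` are invertible diagonal matrices of the same type, then their
centralizers in `U(n,q)` are isomorphic as groups: there is a bijection between the
two centralizers which preserves multiplication. -/
theorem pPowerPaper.stmt13 (F : Type*) [Field F] [Fintype F] [DecidableEq F]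
    (n : ℕ) (hn : 0 < n)
    (d d' : Fin n → F) (hd : ∀ i, d i ≠ 0) (hd' : ∀ i, d' i ≠ 0)
    (htype : typeMultiset d = typeMultiset d') :
    ∃ f : Matrix (Fin n) (Fin n) F → Matrix (Fin n) (Fin n) F,
      Set.BijOn f (centralizerU d) (centralizerU d') ∧
      ∀ x ∈ centralizerU d, ∀ y ∈ centralizerU d, f (x * y) = f x * f y := by
  obtain ⟨σ, hσ, hmono⟩ := exists_perm_of_typeMultiset_eq htype
  have hσ' (i j : Fin n) : d (σ.symm i) = d (σ.symm j) ↔ d' i = d' j := by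
    rw [← hσ, σ.apply_symm_apply, σ.apply_symm_apply]
  have hmono' (i j : Fin n) (hij : d' i = d' j) : σ.symm i < σ.symm j ↔ i < j := by
    rw [← hmono _ _ ((hσ' i j).2 hij), σ.apply_symm_apply, σ.apply_symm_apply]
  refine ⟨fun u => u.submatrix σ.symm σ.symm,
    Set.InvOn.bijOn (f' := fun u => u.submatrix σ σ) ⟨fun u _ => ?_, fun u _ => ?_⟩
      (fun u hu => submatrix_mem_centralizerU hσ' hmono' hu)
      (fun u hu => submatrix_mem_centralizerU hσ hmono hu),
    fun x _ y _ => (Matrix.submatrix_mul_equiv x y _ σ.symm _).symm⟩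
  · simp
  · simp
end
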